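/- arXiv:cs/0211002 — 2 statements merged into one kernel-verified Lean document; each statement's English description precedes it below -/
import Mathlib

section
/- (Iteration Lemma) For every interpretation I, mechanism γ, boolean expression B, and e-predicate P: if I ⊨ {P ∩ B^I}γ{P}, then I ⊨ {P} while B do γ {P ∩ (¬B)^I}. -/
open scoped Classical

noncomputable section

namespace MPL

/-- Terms over variables `V` and function symbols `F` (function symbols applied to
a stream of arguments; finite arities are modelled by ignoring superfluous arguments). -/
inductive Term (V F : Type) : Type where
  | var : V → Term V F
  | app : F → (ℕ → Term V F) → Term V F

/-- Boolean expressions over variables `V`, function symbols `F` and relation symbols `R`. -/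
inductive BExp (V F R : Type) : Type where
  | tt : BExp V F R
  | rel : R → (ℕ → Term V F) → BExp V F R
  | not : BExp V F R → BExp V F R
  | and : BExp V F R → BExp V F R → BExp V F R

/-- MPL mechanisms: assignment, sequential composition, conditional, while-loop,
and simultaneous choice `ch_A(X)` for a finite nonempty set `A` of agents with
distinct choice variables `X a` for `a ∈ A`. -/
inductive Mech (Ag V F R : Type) : Type where
  | assign : V → Term V F → Mech Ag V F R
  | seq : Mech Ag V F R → Mech Ag V F R → Mech Ag V F R
  | ite : BExp V F R → Mech Ag V F R → Mech Ag V F R → Mech Ag V F R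
  | wh : BExp V F R → Mech Ag V F R → Mech Ag V F R
  | choice : (A : Finset Ag) → A.Nonempty → (X : Ag → V) → Set.InjOn X ↑A → Mech Ag V F R

/-- An interpretation: a domain, interpretations of the function and relation symbols,
and for every agent a preference preorder on the domain with a uniformly worst element. -/
structure Interp (Ag V F R : Type) : Type 1 where
  D : Type
  funI : F → (ℕ → D) → D
  relI : R → (ℕ → D) → Prop
  /-- `pref a d d'` means `d ≥_a d'`. -/
  pref : Ag → D → D → Prop
  pref_refl : ∀ a d, pref a d d
  pref_trans : ∀ a d1 d2 d3, pref a d1 d2 → pref a d2 d3 → pref a d1 d3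
  worst : D
  worst_least : ∀ a d, pref a d worst

variable {Ag V F R : Type}

/-- A state assigns a domain element to every mechanism variable. -/
abbrev State (I : Interp Ag V F R) : Type := V → I.D

/-- Value of a term in an interpretation at a state. -/
def Term.eval (I : Interp Ag V F R) (s : State I) : Term V F → I.D
  | .var x => s x
  | .app f ts => I.funI f (fun n => (ts n).eval I s)

/-- Truth of a boolean expression in an interpretation at a state. -/
def BExp.holds (I : Interp Ag V F R) (s : State I) : BExp V F R → Prop
  | .tt => True
  | .rel r ts => I.relI r (fun n => (ts n).eval I s)
  | .not b => ¬ b.holds I s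
  | .and b1 b2 => b1.holds I s ∧ b2.holds I s

/-- A configuration: a mechanism (or `none` for the empty mechanism Λ) together with a state. -/
abbrev Cfg (I : Interp Ag V F R) : Type := Option (Mech Ag V F R) × State I

/-- Update a state at one variable. -/
def updState (I : Interp Ag V F R) (s : State I) (x : V) (d : I.D) : State I :=
  fun y => if y = x then d else s y

/-- The structured operational semantics: labelled transitions `⟨γ,s⟩ →_A ⟨γ',s'⟩`. -/
inductive Step (I : Interp Ag V F R) : Cfg I → Set Ag → Cfg I → Prop where
  | assign (x : V) (t : Term V F) (s : State I) :
      Step I (some (.assign x t), s) ∅ (none, updState I s x (t.eval I s))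
  | choice (A : Finset Ag) (hA : A.Nonempty) (X : Ag → V) (hX : Set.InjOn X ↑A)
      (s s' : State I) (hagree : ∀ y : V, (∀ a ∈ A, X a ≠ y) → s' y = s y) :
      Step I (some (.choice A hA X hX), s) ↑A (none, s')
  | seqFin {γ1 γ2 s L s'} : Step I (some γ1, s) L (none, s') →
      Step I (some (.seq γ1 γ2), s) L (some γ2, s')
  | seqStep {γ1 γ2 s L γ1' s'} : Step I (some γ1, s) L (some γ1', s') →
      Step I (some (.seq γ1 γ2), s) L (some (.seq γ1' γ2), s')
  | iteT {B γ1 γ2 s} : B.holds I s → Step I (some (.ite B γ1 γ2), s) ∅ (some γ1, s)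
  | iteF {B γ1 γ2 s} : ¬ B.holds I s → Step I (some (.ite B γ1 γ2), s) ∅ (some γ2, s)
  | whF {B γ s} : ¬ B.holds I s → Step I (some (.wh B γ), s) ∅ (none, s)
  | whT {B γ s} : B.holds I s → Step I (some (.wh B γ), s) ∅ (some (.seq γ (.wh B γ)), s)

/-- A (partial) history of the game rooted at `c0`: a nonempty finite sequence of
configurations starting at `c0` and linked by transitions. -/
def IsHist (I : Interp Ag V F R) (c0 : Cfg I) (h : List (Cfg I)) : Prop :=
  h.head? = some c0 ∧ h.Chain' (fun c c' => ∃ L, Step I c L c')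

/-- A strategy profile: for every agent a strategy assigning a chosen value to each history. -/
abbrev Profile (I : Interp Ag V F R) : Type := Ag → List (Cfg I) → I.D

/-- The state resulting from the agents in `A` choosing values for their variables
`X a` according to the profile `σ` at history `h`. -/
def chooseVal (I : Interp Ag V F R) (A : Finset Ag) (X : Ag → V) (σ : Profile I)
    (h : List (Cfg I)) (s : State I) : State I :=
  fun y => if hy : ∃ a, a ∈ A ∧ X a = y then σ hy.choose h else s y

/-- The successor configuration of a (non-empty) configuration, as determined by the
operational semantics together with the choices prescribed by the profile `σ` at history `h`. -/
def next (I : Interp Ag V F R) (σ : Profile I) (h : List (Cfg I)) :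
    Mech Ag V F R → State I → Cfg I
  | .assign x t, s => (none, updState I s x (t.eval I s))
  | .choice A _ X _, s => (none, chooseVal I A X σ h s)
  | .seq γ1 γ2, s =>
      match next I σ h γ1 s with
      | (none, s') => (some γ2, s')
      | (some γ1', s') => (some (.seq γ1' γ2), s')
  | .ite B γ1 γ2, s => if B.holds I s then (some γ1, s) else (some γ2, s)
  | .wh B γ, s => if B.holds I s then (some (.seq γ (.wh B γ)), s) else (none, s)

/-- Extend a history by one step of play according to `σ` (histories ending in Λ stay put). -/
def extend (I : Interp Ag V F R) (σ : Profile I) (h : List (Cfg I)) : List (Cfg I) :=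
  match h.getLast? with
  | some (some γ, s) => h ++ [next I σ h γ s]
  | _ => h

/-- The history of the unique run determined by profile `σ` from `c0`, after `n` steps. -/
def runH (I : Interp Ag V F R) (c0 : Cfg I) (σ : Profile I) : ℕ → List (Cfg I)
  | 0 => [c0]
  | n + 1 => extend I σ (runH I c0 σ n)

/-- A run: the (possibly infinite) sequence of configurations of a maximal play. -/
abbrev Run (I : Interp Ag V F R) : Type := ℕ → Option (Cfg I)

/-- The unique maximal run determined by profile `σ` from initial configuration `c0`. -/
def runOf (I : Interp Ag V F R) (c0 : Cfg I) (σ : Profile I) : Run I :=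
  fun n => (runH I c0 σ n)[n]?

/-- `run(σ)` is finite (reaches the empty mechanism Λ). -/
def Terminates (I : Interp Ag V F R) (c0 : Cfg I) (σ : Profile I) : Prop :=
  ∃ n, ∃ s : State I, (runH I c0 σ n).getLast? = some ((none : Option (Mech Ag V F R)), s)

/-- The final state `s_σ` of a finite run. -/
def finalState (I : Interp Ag V F R) {c0 : Cfg I} {σ : Profile I}
    (h : Terminates I c0 σ) : State I :=
  h.choose_spec.choose

/-- An outcome function assigns an element of the domain to every terminal history
(represented by the corresponding run). -/
abbrev OutcomeF (I : Interp Ag V F R) : Type := Run I → I.D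

/-- An extended predicate (e-predicate): a set of pairs (state, outcome). -/
abbrev EPred (I : Interp Ag V F R) : Type := Set (State I × I.D)

/-- `ô ∈ Ô_Q`: every finite run is assigned an outcome satisfying `Q` at its final state. -/
def memOhat (I : Interp Ag V F R) (c0 : Cfg I) (Q : EPred I) (oh : OutcomeF I) : Prop :=
  ∀ σ : Profile I, ∀ ht : Terminates I c0 σ, (finalState I ht, oh (runOf I c0 σ)) ∈ Q

/-- `σ` is a Nash equilibrium in the game rooted at `c0` with outcome function `oh`. -/
def NashEq (I : Interp Ag V F R) (c0 : Cfg I) (oh : OutcomeF I) (σ : Profile I) : Prop :=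
  ∀ (i : Ag) (τ : Profile I), (∀ j, j ≠ i → τ j = σ j) →
    I.pref i (oh (runOf I c0 σ)) (oh (runOf I c0 τ))

/-- Prepend a finite sequence of configurations to a run. -/
def prependRun (I : Interp Ag V F R) (l : List (Cfg I)) (ρ : Run I) : Run I :=
  fun n => if hn : n < l.length then some l[n] else ρ (n - l.length)

/-- Restriction of an outcome function to the subgame reached via history `h`. -/
def restrictO (I : Interp Ag V F R) (h : List (Cfg I)) (oh : OutcomeF I) : OutcomeF I :=
  fun ρ => oh (prependRun I h.dropLast ρ)

/-- Restriction of a strategy profile to the subgame reached via history `h`. -/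
def restrictP (I : Interp Ag V F R) (h : List (Cfg I)) (σ : Profile I) : Profile I :=
  fun a h' => σ a (h.dropLast ++ h')

/-- `σ` is a subgame-perfect equilibrium in `G(γ,s,I,oh)`: its restriction to every
subgame (rooted at any configuration reachable from `⟨γ,s⟩`) is a Nash equilibrium there. -/
def SPE (I : Interp Ag V F R) (γ : Mech Ag V F R) (s : State I)
    (oh : OutcomeF I) (σ : Profile I) : Prop :=
  ∀ (h : List (Cfg I)) (c : Cfg I), IsHist I (some γ, s) h → h.getLast? = some c →
    NashEq I c (restrictO I h oh) (restrictP I h σ)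

/-- The correctness assertion `I ⊨ {P} γ {Q}`. -/
def Valid (I : Interp Ag V F R) (P : EPred I) (γ : Mech Ag V F R) (Q : EPred I) : Prop :=
  ∀ so ∈ P, ∃ (oh : OutcomeF I) (σ : Profile I),
    memOhat I (some γ, so.1) Q oh ∧ SPE I γ so.1 oh σ ∧ oh (runOf I (some γ, so.1) σ) = so.2

/-- The weakest precondition `wpre(γ,Q,I)`. -/
def wpre (I : Interp Ag V F R) (γ : Mech Ag V F R) (Q : EPred I) : EPred I :=
  {so | ∃ (oh : OutcomeF I) (σ : Profile I),
    memOhat I (some γ, so.1) Q oh ∧ SPE I γ so.1 oh σ ∧ oh (runOf I (some γ, so.1) σ) = so.2}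

/-- The substituted e-predicate `Q[x/t]`. -/
def substPred (I : Interp Ag V F R) (Q : EPred I) (x : V) (t : Term V F) : EPred I :=
  {so | (updState I so.1 x (t.eval I so.1), so.2) ∈ Q}

/-- `B^I ∩ P`. -/
def gate (I : Interp Ag V F R) (B : BExp V F R) (P : EPred I) : EPred I :=
  {so | so ∈ P ∧ B.holds I so.1}

/-- `(¬B)^I ∩ P`. -/
def gateN (I : Interp Ag V F R) (B : BExp V F R) (P : EPred I) : EPred I :=
  {so | so ∈ P ∧ ¬ B.holds I so.1}

/-- The Hoare-style calculus for mechanisms: `I ⊢ {P} γ {Q}`. -/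
inductive Deriv (I : Interp Ag V F R) : EPred I → Mech Ag V F R → EPred I → Prop where
  | assign (Q : EPred I) (x : V) (t : Term V F) :
      Deriv I (substPred I Q x t) (.assign x t) Q
  | choice (A : Finset Ag) (hA : A.Nonempty) (X : Ag → V) (hX : Set.InjOn X ↑A)
      (Q : EPred I) :
      Deriv I (wpre I (.choice A hA X hX) Q) (.choice A hA X hX) Q
  | comp {P R' Q : EPred I} {γ1 γ2 : Mech Ag V F R} :
      Deriv I P γ1 R' → Deriv I R' γ2 Q → Deriv I P (.seq γ1 γ2) Q
  | ifR {P Q : EPred I} {B : BExp V F R} {γ1 γ2 : Mech Ag V F R} :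
      Deriv I (gate I B P) γ1 Q → Deriv I (gateN I B P) γ2 Q →
      Deriv I P (.ite B γ1 γ2) Q
  | whileR {P : EPred I} {B : BExp V F R} {γ : Mech Ag V F R} :
      Deriv I (gate I B P) γ P → Deriv I P (.wh B γ) (gateN I B P)
  | conseq {P P' Q Q' : EPred I} {γ : Mech Ag V F R} :
      P ⊆ P' → Deriv I P' γ Q' → Q' ⊆ Q → Deriv I P γ Q

/-- The Nash-equilibrium variant of validity. -/
def NashValid (I : Interp Ag V F R) (P : EPred I) (γ : Mech Ag V F R) (Q : EPred I) : Prop :=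
  ∀ so ∈ P, ∃ (oh : OutcomeF I) (σ : Profile I),
    memOhat I (some γ, so.1) Q oh ∧ NashEq I (some γ, so.1) oh σ ∧
    oh (runOf I (some γ, so.1) σ) = so.2

/-- Mechanisms without any `ch_A` construct, i.e. ordinary programs (MPL(PRG)). -/
def ChoiceFree : Mech Ag V F R → Prop
  | .assign _ _ => True
  | .seq γ1 γ2 => ChoiceFree γ1 ∧ ChoiceFree γ2
  | .ite _ γ1 γ2 => ChoiceFree γ1 ∧ ChoiceFree γ2
  | .wh _ γ => ChoiceFree γ
  | .choice _ _ _ _ => False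

/-- Standard Hoare partial correctness: every finite maximal execution of `γ`
from a state in `P` terminates in a state in `Q`. -/
def HoarePartial (I : Interp Ag V F R) (P : Set (State I)) (γ : Mech Ag V F R)
    (Q : Set (State I)) : Prop :=
  ∀ s ∈ P, ∀ (h : List (Cfg I)) (t : State I),
    IsHist I (some γ, s) h → h.getLast? = some ((none : Option (Mech Ag V F R)), t) → t ∈ Q

end MPL

namespace MPL

variable {Ag V F R : Type}

/-- The run that lists the entries of a finite history and is undefined afterwards. -/
def listRun (I : Interp Ag V F R) (h : List (Cfg I)) : Run I := fun n => h[n]?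

/-- The maximal run obtained by letting `σ` play on from the history `h`. -/
def contRun (I : Interp Ag V F R) (σ : Profile I) (h : List (Cfg I)) : Run I :=
  fun n => ((extend I σ)^[n] h)[n]?

section Extend

variable {I : Interp Ag V F R} {σ τ : Profile I}

theorem extend_concat_some (h : List (Cfg I)) (γ : Mech Ag V F R) (s : State I) :
    extend I σ (h ++ [(some γ, s)]) = h ++ [(some γ, s)] ++ [next I σ (h ++ [(some γ, s)]) γ s] := by
  simp [extend]

theorem extend_concat_none (h : List (Cfg I)) (s : State I) :
    extend I σ (h ++ [(none, s)]) = h ++ [(none, s)] := by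
  simp [extend]

theorem extend_eq_or (h : List (Cfg I)) :
    extend I σ h = h ∨ ∃ c, extend I σ h = h ++ [c] := by
  unfold extend
  split
  · exact Or.inr ⟨_, rfl⟩
  · exact Or.inl rfl

theorem prefix_iterate_extend (h : List (Cfg I)) (n : ℕ) : h <+: (extend I σ)^[n] h := by
  induction n with
  | zero => exact List.prefix_rfl
  | succ n ih =>
    rw [Function.iterate_succ_apply']
    refine ih.trans ?_
    rcases extend_eq_or (σ := σ) ((extend I σ)^[n] h) with e | ⟨c, e⟩
    · rw [e]
    · rw [e]
      exact List.prefix_append _ _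

theorem iterate_extend_stuck_or (h : List (Cfg I)) (hne : h ≠ []) (n : ℕ) :
    extend I σ ((extend I σ)^[n] h) = (extend I σ)^[n] h ∨ n < ((extend I σ)^[n] h).length := by
  induction n with
  | zero => exact Or.inr (List.length_pos_iff.mpr hne)
  | succ n ih =>
    rw [Function.iterate_succ_apply']
    rcases ih with e | hl
    · exact Or.inl (by rw [e, e])
    · rcases extend_eq_or (σ := σ) ((extend I σ)^[n] h) with e | ⟨c, e⟩
      · exact Or.inl (by rw [e, e])
      · right
        rw [e]
        simp only [List.length_append, List.length_singleton]
        omega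

theorem getElem?_of_prefix {α : Type*} {l l' : List α} (hp : l <+: l') {n : ℕ} {a : α}
    (ha : l[n]? = some a) : l'[n]? = some a := by
  obtain ⟨t, rfl⟩ := hp
  have hn := (List.getElem?_eq_some_iff.mp ha).1
  rw [List.getElem?_append_left hn, ha]

theorem contRun_eq_some_iff {h : List (Cfg I)} (hne : h ≠ []) {n : ℕ} {c : Cfg I} :
    contRun I σ h n = some c ↔ ∃ m, ((extend I σ)^[m] h)[n]? = some c := by
  refine ⟨fun e => ⟨n, e⟩, ?_⟩
  rintro ⟨m, hm⟩
  unfold contRun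
  rcases le_total m n with hmn | hnm
  · obtain ⟨d, rfl⟩ := Nat.exists_eq_add_of_le hmn
    rw [Nat.add_comm, Function.iterate_add_apply] at *
    exact getElem?_of_prefix (prefix_iterate_extend _ _) hm
  · obtain ⟨d, rfl⟩ := Nat.exists_eq_add_of_le hnm
    rw [Nat.add_comm, Function.iterate_add_apply] at hm
    rcases iterate_extend_stuck_or (σ := σ) h hne n with e | hl
    · rwa [Function.iterate_fixed e] at hm
    · have h1 := List.getElem?_eq_getElem hl
      rw [getElem?_of_prefix (prefix_iterate_extend _ _) h1] at hm
      rw [h1, hm]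

theorem contRun_extend {h : List (Cfg I)} (hne : h ≠ []) :
    contRun I σ (extend I σ h) = contRun I σ h := by
  have hne' : extend I σ h ≠ [] := by
    rcases extend_eq_or (σ := σ) h with e | ⟨c, e⟩ <;> rw [e] <;> simp [hne]
  funext n
  apply Option.ext
  intro c
  rw [contRun_eq_some_iff hne, contRun_eq_some_iff hne']
  constructor
  · rintro ⟨m, hm⟩
    exact ⟨m + 1, hm⟩
  · rintro ⟨m, hm⟩
    refine ⟨m, ?_⟩
    rw [← Function.iterate_succ_apply, Function.iterate_succ_apply']
    exact getElem?_of_prefix (prefix_iterate_extend _ 1) hm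

theorem iterate_extend_ne_nil {h : List (Cfg I)} (hne : h ≠ []) (m : ℕ) :
    (extend I σ)^[m] h ≠ [] := by
  intro e
  have := prefix_iterate_extend (σ := σ) h m
  rw [e] at this
  exact hne (List.prefix_nil.mp this)

theorem contRun_iterate_extend {h : List (Cfg I)} (hne : h ≠ []) (m : ℕ) :
    contRun I σ ((extend I σ)^[m] h) = contRun I σ h := by
  induction m with
  | zero => rfl
  | succ m ih => rw [Function.iterate_succ_apply', contRun_extend (iterate_extend_ne_nil hne m), ih]

theorem contRun_concat_none (h : List (Cfg I)) (s : State I) :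
    contRun I σ (h ++ [(none, s)]) = listRun I (h ++ [(none, s)]) := by
  funext n
  simp only [contRun, listRun]
  rw [Function.iterate_fixed (extend_concat_none h s)]

theorem contRun_of_lt {h : List (Cfg I)} {n : ℕ} (hn : n < h.length) :
    contRun I σ h n = h[n]? := by
  have h1 := List.getElem?_eq_getElem hn
  rw [h1, contRun_eq_some_iff (by rintro rfl; simp at hn)]
  exact ⟨0, h1⟩

theorem next_congr {h h' : List (Cfg I)} (e : ∀ a, σ a h = τ a h') (γ : Mech Ag V F R)
    (s : State I) : next I σ h γ s = next I τ h' γ s := by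
  induction γ with
  | assign x t => rfl
  | choice A hA X hX =>
    simp only [next, Prod.mk.injEq, true_and]
    funext y
    unfold chooseVal
    simp only [e]
  | seq γ₁ γ₂ ih₁ _ => simp only [next, ih₁]
  | ite b γ₁ γ₂ _ _ => rfl
  | wh b γ _ => rfl

theorem step_next (h : List (Cfg I)) (γ : Mech Ag V F R) (s : State I) :
    ∃ L, Step I (some γ, s) L (next I σ h γ s) := by
  induction γ with
  | assign x t => exact ⟨_, Step.assign x t s⟩
  | choice A hA X hX =>
    refine ⟨_, Step.choice A hA X hX s _ ?_⟩
    intro y hy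
    rw [chooseVal, dif_neg]
    rintro ⟨a, ha, e⟩
    exact hy a ha e
  | seq γ₁ γ₂ ih₁ _ =>
    obtain ⟨L, hL⟩ := ih₁
    refine ⟨L, ?_⟩
    simp only [next]
    rcases e : next I σ h γ₁ s with ⟨_ | γ', s'⟩
    · exact Step.seqFin (e ▸ hL)
    · exact Step.seqStep (e ▸ hL)
  | ite b γ₁ γ₂ _ _ =>
    simp only [next]
    split
    · exact ⟨_, Step.iteT ‹_›⟩
    · exact ⟨_, Step.iteF ‹_›⟩
  | wh b γ _ =>
    simp only [next]
    split
    · exact ⟨_, Step.whT ‹_›⟩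
    · exact ⟨_, Step.whF ‹_›⟩

/-- Every transition is prescribed by a suitable choice of values of the agents. -/
theorem Step.exists_choice {c c' : Cfg I} {L : Set Ag} (hs : Step I c L c') :
    ∃ f : Ag → I.D, ∀ (γ : Mech Ag V F R) (h : List (Cfg I)) (σ : Profile I),
      c.1 = some γ → (∀ a, σ a h = f a) → next I σ h γ c.2 = c' := by
  induction hs with
  | assign x t s =>
    refine ⟨fun _ => I.worst, ?_⟩
    rintro _ h σ ⟨⟩ _
    rfl
  | choice A hA X hX s s' hagree =>
    refine ⟨fun a => s' (X a), ?_⟩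
    rintro _ h σ ⟨⟩ e
    simp only [next, Prod.mk.injEq, true_and]
    funext y
    unfold chooseVal
    split
    · rename_i hy
      exact (e _).trans (congrArg s' hy.choose_spec.2)
    · rename_i hy
      exact (hagree y fun a ha e => hy ⟨a, ha, e⟩).symm
  | seqFin _ ih =>
    obtain ⟨f, hf⟩ := ih
    refine ⟨f, ?_⟩
    rintro _ h σ ⟨⟩ e
    have := hf _ h σ rfl e
    simp only at this
    simp only [next, this]
  | seqStep _ ih =>
    obtain ⟨f, hf⟩ := ih
    refine ⟨f, ?_⟩
    rintro _ h σ ⟨⟩ e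
    have := hf _ h σ rfl e
    simp only at this
    simp only [next, this]
  | iteT hb | iteF hb | whF hb | whT hb =>
    refine ⟨fun _ => I.worst, ?_⟩
    rintro _ h σ ⟨⟩ _
    simp [next, hb]

end Extend

section Hist

variable {I : Interp Ag V F R} {σ τ : Profile I} {c₀ : Cfg I}

theorem isHist_iff {h : List (Cfg I)} :
    IsHist I c₀ h ↔ h.head? = some c₀ ∧ h.IsChain (fun c c' => ∃ L, Step I c L c') :=
  Iff.rfl

theorem isHist_singleton : IsHist I c₀ [c₀] := by
  simp [isHist_iff]

theorem IsHist.ne_nil {h : List (Cfg I)} (hh : IsHist I c₀ h) : h ≠ [] := by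
  rintro rfl
  simp [IsHist] at hh

theorem isHist_concat_concat {h : List (Cfg I)} {c d : Cfg I} :
    IsHist I c₀ (h ++ [c] ++ [d]) ↔ IsHist I c₀ (h ++ [c]) ∧ ∃ L, Step I c L d := by
  simp only [isHist_iff, List.append_assoc, List.singleton_append]
  rw [List.isChain_append_cons_cons]
  simp only [List.isChain_singleton, and_true]
  cases h <;> simp [and_assoc]

/-- Induction over histories by appending one transition at a time. -/
theorem IsHist.rec_concat {motive : List (Cfg I) → Prop} (base : motive [c₀])
    (step : ∀ h c d, IsHist I c₀ (h ++ [c]) → (∃ L, Step I c L d) → motive (h ++ [c]) →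
      motive (h ++ [c] ++ [d])) {h : List (Cfg I)} (hh : IsHist I c₀ h) : motive h := by
  induction h using List.reverseRecOn with
  | nil => exact absurd rfl hh.ne_nil
  | append_singleton l d ih =>
    rcases List.eq_nil_or_concat l with rfl | ⟨l', c, rfl⟩
    · simp only [IsHist, List.nil_append, List.head?_cons, Option.some.injEq] at hh
      rw [hh.1]
      exact base
    · simp only [List.concat_eq_append] at *
      obtain ⟨h1, h2⟩ := isHist_concat_concat.mp hh
      exact step _ _ _ h1 h2 (ih h1)

theorem IsHist.extend {h : List (Cfg I)} (hh : IsHist I c₀ h) : IsHist I c₀ (extend I σ h) := by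
  rcases List.eq_nil_or_concat h with rfl | ⟨l, ⟨_ | γ, s⟩, rfl⟩
  · exact absurd rfl hh.ne_nil
  · rw [List.concat_eq_append, extend_concat_none]
    simpa using hh
  · rw [List.concat_eq_append] at *
    rw [extend_concat_some]
    exact isHist_concat_concat.mpr ⟨hh, step_next _ _ _⟩

theorem IsHist.iterate_extend {h : List (Cfg I)} (hh : IsHist I c₀ h) (n : ℕ) :
    IsHist I c₀ ((MPL.extend I σ)^[n] h) := by
  induction n with
  | zero => exact hh
  | succ n ih =>
    rw [Function.iterate_succ_apply']
    exact ih.extend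

theorem iterate_extend_congr {h : List (Cfg I)} {n : ℕ}
    (e : ∀ a l, l.length < h.length + n → σ a l = τ a l) :
    (extend I σ)^[n] h = (extend I τ)^[n] h ∧
      ((extend I σ)^[n] h).length ≤ h.length + n := by
  induction n with
  | zero => exact ⟨rfl, le_rfl⟩
  | succ n ih =>
    obtain ⟨e1, e2⟩ := ih fun a l hl => e a l (by omega)
    rw [Function.iterate_succ_apply', Function.iterate_succ_apply', ← e1]
    generalize (extend I σ)^[n] h = g at e2
    rcases List.eq_nil_or_concat g with rfl | ⟨l, ⟨_ | γ, s⟩, rfl⟩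
    · simp [extend]
    · rw [List.concat_eq_append] at *
      rw [extend_concat_none, extend_concat_none]
      exact ⟨rfl, by omega⟩
    · rw [List.concat_eq_append] at *
      rw [extend_concat_some, extend_concat_some,
        next_congr (τ := τ) (h' := l ++ [(some γ, s)]) fun a => e a _ (by omega)]
      refine ⟨rfl, ?_⟩
      rw [List.length_append, List.length_singleton]
      omega

/-- Every history is played by some strategy profile. -/
theorem IsHist.exists_profile {h : List (Cfg I)} (hh : IsHist I c₀ h) :
    ∃ σ : Profile I, (MPL.extend I σ)^[h.length - 1] [c₀] = h := by
  refine IsHist.rec_concat (motive := fun h => ∃ σ : Profile I,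
    (MPL.extend I σ)^[h.length - 1] [c₀] = h) ⟨fun _ _ => I.worst, rfl⟩ ?_ hh
  rintro l ⟨g, s⟩ d hl ⟨L, hs⟩ ⟨σ, hσ⟩
  obtain ⟨f, hf⟩ := hs.exists_choice
  obtain ⟨γ, rfl⟩ : ∃ γ, g = some γ := by
    cases hs <;> exact ⟨_, rfl⟩
  set p := l ++ [((some γ, s) : Cfg I)] with hp
  let σ' : Profile I := fun a q => if q = p then f a else σ a q
  refine ⟨σ', ?_⟩
  have hlen : (p ++ [d]).length - 1 = (p.length - 1) + 1 := by simp [hp]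
  have hagree := iterate_extend_congr (σ := σ') (τ := σ) (h := [c₀]) (n := p.length - 1) (by
    intro a q hq
    have : q ≠ p := by
      rintro rfl
      simp [hp] at hq
      omega
    simp [σ', this])
  rw [hlen, Function.iterate_succ_apply', hagree.1, hσ, hp, extend_concat_some, ← hp,
    hf γ p σ' rfl fun a => by simp [σ']]

theorem IsHist.fst_ne_none {h : List (Cfg I)} {c : Cfg I} (hh : IsHist I c₀ (h ++ [c])) :
    ∀ d ∈ h, d.1 ≠ none := by
  suffices H : ∀ q, IsHist I c₀ q → ∀ h c, q = h ++ [c] → ∀ d ∈ h, d.1 ≠ none from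
    H _ hh h c rfl
  intro q hq
  refine IsHist.rec_concat (motive := fun q => ∀ h c, q = h ++ [c] → ∀ d ∈ h, d.1 ≠ none)
    ?_ ?_ hq
  · intro h c e d hd
    have : h = [] := by simpa using congrArg List.length e
    simp [this] at hd
  · rintro l a b _ ⟨L, hs⟩ ih h c e d hd
    obtain ⟨rfl, -⟩ := List.append_inj' e rfl
    rcases List.mem_append.mp hd with hd | hd
    · exact ih l a rfl d hd
    · rw [List.mem_singleton.mp hd]
      cases hs <;> simp

end Hist

section Game

variable {I : Interp Ag V F R}

theorem runH_eq_iterate (c : Cfg I) (σ : Profile I) (n : ℕ) :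
    runH I c σ n = (extend I σ)^[n] [c] := by
  induction n with
  | zero => rfl
  | succ n ih => rw [Function.iterate_succ_apply', ← ih, runH]

theorem runOf_eq_contRun (c : Cfg I) (σ : Profile I) : runOf I c σ = contRun I σ [c] := by
  funext n
  simp only [runOf, contRun, runH_eq_iterate]

theorem extend_append {σ σ' : Profile I} {p : List (Cfg I)}
    (e : ∀ a l, σ' a l = σ a (p ++ l)) {l : List (Cfg I)} (hl : l ≠ []) :
    extend I σ (p ++ l) = p ++ extend I σ' l := by
  rcases List.eq_nil_or_concat l with rfl | ⟨l, ⟨_ | γ, s⟩, rfl⟩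
  · exact absurd rfl hl
  · rw [List.concat_eq_append, ← List.append_assoc, extend_concat_none, extend_concat_none,
      List.append_assoc]
  · rw [List.concat_eq_append, ← List.append_assoc, extend_concat_some, extend_concat_some,
      next_congr (τ := σ') (h' := l ++ [(some γ, s)]) (by intro a; rw [e, List.append_assoc])]
    simp only [List.append_assoc]

theorem prependRun_contRun {σ σ' : Profile I} {p : List (Cfg I)}
    (e : ∀ a l, σ' a l = σ a (p ++ l)) {l : List (Cfg I)} (hl : l ≠ []) :
    prependRun I p (contRun I σ' l) = contRun I σ (p ++ l) := by
  have hit : ∀ m, (extend I σ)^[m] (p ++ l) = p ++ (extend I σ')^[m] l := by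
    intro m
    induction m with
    | zero => rfl
    | succ m ih =>
      rw [Function.iterate_succ_apply', Function.iterate_succ_apply', ih,
        extend_append e (iterate_extend_ne_nil hl m)]
  funext n
  unfold prependRun
  split
  · rename_i hn
    rw [contRun_of_lt (by simp; omega), List.getElem?_append_left hn, List.getElem?_eq_getElem hn]
  · rename_i hn
    apply Option.ext
    intro c
    rw [contRun_eq_some_iff hl, contRun_eq_some_iff (by simp [hl])]
    simp only [hit, List.getElem?_append_right (not_lt.mp hn)]

theorem restrictO_runOf {oh : OutcomeF I} {σ : Profile I} {h : List (Cfg I)} {c : Cfg I} :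
    restrictO I (h ++ [c]) oh (runOf I c (restrictP I (h ++ [c]) σ)) =
      oh (contRun I σ (h ++ [c])) := by
  unfold restrictO
  rw [runOf_eq_contRun, List.dropLast_concat, prependRun_contRun (σ := σ) _ (by simp)]
  intro a l
  simp [restrictP]

/-- Subgame perfection in terms of the continuations of histories in the whole game. -/
theorem spe_iff {γ : Mech Ag V F R} {s : State I} {oh : OutcomeF I} {σ : Profile I} :
    SPE I γ s oh σ ↔ ∀ h, IsHist I (some γ, s) h → ∀ (i : Ag) (τ : Profile I),
      (∀ j, j ≠ i → τ j = σ j) →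
        I.pref i (oh (contRun I σ h)) (oh (contRun I τ h)) := by
  constructor
  · intro H h hh i τ hτ
    rcases List.eq_nil_or_concat h with rfl | ⟨l, c, rfl⟩
    · exact absurd rfl hh.ne_nil
    · rw [List.concat_eq_append] at *
      have := H _ c hh (by simp) i (restrictP I (l ++ [c]) τ) (by
        intro j hj
        funext q
        simp only [restrictP, hτ j hj])
      rwa [restrictO_runOf, restrictO_runOf] at this
  · intro H h c hh hc i τ hτ
    obtain ⟨l, rfl⟩ := List.getLast?_eq_some_iff.mp hc
    let τ' : Profile I := fun j => if j = i then fun q => τ i (q.drop l.length) else σ j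
    have hrestrict : restrictP I (l ++ [c]) τ' = τ := by
      funext j q
      by_cases hj : j = i
      · subst hj
        simp [restrictP, τ']
      · rw [hτ j hj]
        simp [restrictP, τ', hj]
    have := H _ hh i τ' (by
      intro j hj
      simp [τ', hj])
    rw [← restrictO_runOf (oh := oh), ← restrictO_runOf (oh := oh), hrestrict] at this
    exact this

theorem iterate_extend_final_unique {σ : Profile I} {x l l' : List (Cfg I)} {s t : State I}
    {m n : ℕ} (hm : (extend I σ)^[m] x = l ++ [(none, s)])
    (hn : (extend I σ)^[n] x = l' ++ [(none, t)]) : s = t := by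
  wlog hmn : m ≤ n generalizing m n s t l l'
  · exact (this hn hm (le_of_not_ge hmn)).symm
  obtain ⟨d, rfl⟩ := Nat.exists_eq_add_of_le hmn
  rw [Nat.add_comm, Function.iterate_add_apply, hm,
    Function.iterate_fixed (extend_concat_none l s)] at hn
  have := (List.append_inj' hn rfl).2
  simpa using this

theorem exists_iterate_extend_finalState {c₀ : Cfg I} {σ : Profile I} (ht : Terminates I c₀ σ) :
    ∃ n l, (extend I σ)^[n] [c₀] = l ++ [(none, finalState I ht)] := by
  obtain ⟨l, hl⟩ := List.getLast?_eq_some_iff.mp ht.choose_spec.choose_spec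
  exact ⟨ht.choose, l, (runH_eq_iterate c₀ σ _).symm.trans hl⟩

/-- Membership in `Ô_Q` in terms of terminated histories. -/
theorem memOhat_iff {c₀ : Cfg I} {Q : EPred I} {oh : OutcomeF I} :
    memOhat I c₀ Q oh ↔ ∀ h s, IsHist I c₀ (h ++ [(none, s)]) →
      (s, oh (listRun I (h ++ [(none, s)]))) ∈ Q := by
  have hrun : ∀ {σ : Profile I} {n : ℕ} {h : List (Cfg I)} {s : State I},
      (extend I σ)^[n] [c₀] = h ++ [(none, s)] →
        runOf I c₀ σ = listRun I (h ++ [(none, s)]) := by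
    intro σ n h s e
    rw [runOf_eq_contRun, ← contRun_iterate_extend (by simp) n, e, contRun_concat_none]
  constructor
  · intro H h s hh
    obtain ⟨σ, hσ⟩ := hh.exists_profile
    have ht : Terminates I c₀ σ := ⟨_, s, by rw [runH_eq_iterate, hσ]; simp⟩
    obtain ⟨n, l, hl⟩ := exists_iterate_extend_finalState ht
    have hs : finalState I ht = s := iterate_extend_final_unique hl hσ
    have := H σ ht
    rwa [hs, hrun hσ] at this
  · intro H σ ht
    obtain ⟨n, l, hl⟩ := exists_iterate_extend_finalState ht
    have hh : IsHist I c₀ (l ++ [(none, finalState I ht)]) :=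
      hl ▸ isHist_singleton.iterate_extend _
    have hr := hrun hl
    rw [hr]
    exact H l _ hh

end Game

section Loop

variable {I : Interp Ag V F R}

/-- A configuration of the loop body, seen inside the loop `w`. -/
def liftCfg (I : Interp Ag V F R) (w : Mech Ag V F R) : Cfg I → Cfg I
  | (some g, s) => (some (.seq g w), s)
  | (none, s) => (some w, s)

/-- The configuration of the loop body underlying a configuration of the loop. -/
def lowerCfg (I : Interp Ag V F R) : Cfg I → Cfg I
  | (some (.seq g _), s) => (some g, s)
  | (_, s) => (none, s)

/-- The run of the loop body with which a run of the loop starts. -/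
def bodyRun (I : Interp Ag V F R) (ρ : Run I) : Run I := fun n =>
  if ∃ m < n, ∀ g g' s, ρ m ≠ some (some (.seq g g'), s) then none else (ρ n).map (lowerCfg I)

/-- Remove the first round from a run of the loop with guard `B`, updating the promised outcome
according to the outcome functions `OH` of the body. -/
def advance (B : BExp V F R) (OH : State I × I.D → OutcomeF I) (x : Run I × I.D) : Run I × I.D :=
  match x.1 0 with
  | some (some _, s) =>
      if B.holds I s then
        (if h : ∃ m s', bodyRun I (fun n => x.1 (n + 1)) m = some (none, s') then
            fun n => x.1 (n + (Nat.find h + 1))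
          else fun _ => none,
          OH (s, x.2) (bodyRun I (fun n => x.1 (n + 1))))
      else x
  | _ => x

/-- The outcome of a run of the loop: the eventual value of the promised outcomes if there is one,
and the worst outcome otherwise. -/
def loopOutcome (B : BExp V F R) (OH : State I × I.D → OutcomeF I) (o₀ : I.D) : OutcomeF I :=
  fun ρ => if h : ∃ d N, ∀ n ≥ N, ((advance B OH)^[n] (ρ, o₀)).2 = d then h.choose else I.worst

/-- Handle one configuration of a loop history, keeping track of the state and promised outcome at
the start of the current round and of the history of the body within that round. -/
def trackStep (OH : State I × I.D → OutcomeF I) (x : (State I × I.D) × List (Cfg I)) :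
    Cfg I → (State I × I.D) × List (Cfg I)
  | (some (.seq g _), s) => (x.1, x.2 ++ [(some g, s)])
  | (_, s) => ((s, OH x.1 (listRun I (x.2 ++ [(none, s)]))), [])

/-- In each round, play the profile of the body for the current state and promised outcome. -/
def loopProfile (OH : State I × I.D → OutcomeF I) (SG : State I × I.D → Profile I)
    (so₀ : State I × I.D) : Profile I := fun a h =>
  SG (h.tail.foldl (trackStep OH) (so₀, [])).1 a (h.tail.foldl (trackStep OH) (so₀, [])).2

/-- `Boundary γ B OH so₀ k H so`: the loop history `H` consists of exactly `k` complete rounds,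
after which the state and the promised outcome are given by `so`. -/
inductive Boundary (γ : Mech Ag V F R) (B : BExp V F R) (OH : State I × I.D → OutcomeF I)
    (so₀ : State I × I.D) : ℕ → List (Cfg I) → State I × I.D → Prop where
  | base : Boundary γ B OH so₀ 0 [(some (.wh B γ), so₀.1)] so₀
  | step {k H so hb s'} : Boundary γ B OH so₀ k H so → B.holds I so.1 →
      IsHist I (some γ, so.1) (hb ++ [(none, s')]) →
      Boundary γ B OH so₀ (k + 1) (H ++ (hb ++ [(none, s')]).map (liftCfg I (.wh B γ)))
        (s', OH so (listRun I (hb ++ [(none, s')])))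

variable {γ : Mech Ag V F R} {B : BExp V F R} {OH : State I × I.D → OutcomeF I}
  {SG : State I × I.D → Profile I} {so₀ so : State I × I.D} {k : ℕ} {H hb : List (Cfg I)}
  {P : EPred I}

theorem lowerCfg_liftCfg (c : Cfg I) : lowerCfg I (liftCfg I (.wh B γ) c) = c := by
  rcases c with ⟨_ | g, s⟩ <;> rfl

theorem bodyRun_eq {b ρ : Run I}
    (h₁ : ∀ n, (∀ m < n, ∃ g s, b m = some (some g, s)) →
      ρ n = (b n).map (liftCfg I (.wh B γ)))
    (h₂ : ∀ m n, m < n → (∀ g s, b m ≠ some (some g, s)) → b n = none) :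
    bodyRun I ρ = b := by
  have hseq : ∀ m, (∀ j < m, ∃ g s, b j = some (some g, s)) → (∃ g s, b m = some (some g, s)) →
      ∃ g g' s, ρ m = some (some (.seq g g'), s) := by
    rintro m hm ⟨g, s, e⟩
    exact ⟨g, .wh B γ, s, by rw [h₁ m hm, e]; rfl⟩
  funext n
  unfold bodyRun
  by_cases hn : ∀ m < n, ∃ g s, b m = some (some g, s)
  · rw [if_neg, h₁ n hn, Option.map_map]
    · have : lowerCfg I ∘ liftCfg I (.wh B γ) = id := funext lowerCfg_liftCfg
      rw [this, Option.map_id, id]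
    · rintro ⟨m, hm, e⟩
      obtain ⟨g, g', s, e'⟩ := hseq m (fun j hj => hn j (hj.trans hm)) (hn m hm)
      exact e g g' s e'
  · have hex : ∃ m, m < n ∧ ¬ ∃ g s, b m = some (some g, s) := by
      push Not at hn ⊢
      exact hn
    obtain ⟨hlt, hmin⟩ := Nat.find_spec hex
    have hbefore : ∀ j < Nat.find hex, ∃ g s, b j = some (some g, s) := by
      intro j hj
      have := Nat.find_min hex hj
      by_contra hc
      exact this ⟨hj.trans hlt, hc⟩
    rw [if_pos, h₂ _ n hlt (fun g s e => hmin ⟨g, s, e⟩)]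
    refine ⟨_, hlt, ?_⟩
    intro g g' s e
    rw [h₁ _ hbefore] at e
    rcases eb : b (Nat.find hex) with _ | ⟨_ | q, t⟩
    · rw [eb] at e
      simp at e
    · rw [eb] at e
      simp [liftCfg] at e
    · exact hmin ⟨q, t, eb⟩

theorem advance_of_not_holds {ρ : Run I} {o : I.D} {g : Mech Ag V F R} {s : State I}
    (h₀ : ρ 0 = some (some g, s)) (hB : ¬ B.holds I s) : advance B OH (ρ, o) = (ρ, o) := by
  simp [advance, h₀, hB]

theorem advance_none (o : I.D) : advance B OH ((fun _ => none), o) = ((fun _ => none), o) := by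
  simp [advance]

theorem advance_of_terminated {ρ : Run I} {s s' : State I} {o : I.D} {g : Mech Ag V F R}
    (h₀ : ρ 0 = some (some g, s)) (hB : B.holds I s) (hlive : ∀ d ∈ hb, d.1 ≠ none)
    (hρ : ∀ n < hb.length + 1,
      ρ (n + 1) = ((hb ++ [(none, s')]).map (liftCfg I (.wh B γ)))[n]?) :
    advance B OH (ρ, o) =
      ((fun n => ρ (n + (hb.length + 1))), OH (s, o) (listRun I (hb ++ [(none, s')]))) := by
  have hlast : listRun I (hb ++ [(none, s')]) hb.length = some (none, s') := by
    simp [listRun]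
  have hsome : ∀ n < hb.length, ∃ g s, listRun I (hb ++ [(none, s')]) n = some (some g, s) := by
    intro n hn
    have h1 := hlive hb[n] (List.getElem_mem hn)
    obtain ⟨g, hg⟩ := Option.ne_none_iff_exists'.mp h1
    refine ⟨g, hb[n].2, ?_⟩
    simp only [listRun]
    rw [List.getElem?_append_left hn, List.getElem?_eq_getElem hn, ← hg]
  have hbody : bodyRun I (fun n => ρ (n + 1)) = listRun I (hb ++ [(none, s')]) := by
    refine bodyRun_eq (B := B) (γ := γ) ?_ ?_
    · intro n hn
      have : n < hb.length + 1 := by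
        by_contra hc
        obtain ⟨g, t, e⟩ := hn hb.length (by omega)
        rw [hlast] at e
        simp at e
      rw [hρ n this, List.getElem?_map]
      rfl
    · intro m n hmn hm
      have : hb.length ≤ m := by
        by_contra hc
        obtain ⟨g, t, e⟩ := hsome m (by omega)
        exact hm g t e
      simp only [listRun]
      rw [List.getElem?_eq_none]
      simp
      omega
  have hex : ∃ m t, listRun I (hb ++ [(none, s')]) m = some (none, t) := ⟨_, _, hlast⟩
  have hfind : Nat.find hex = hb.length := by
    rw [Nat.find_eq_iff]
    refine ⟨⟨_, hlast⟩, ?_⟩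
    rintro n hn ⟨t, e⟩
    obtain ⟨g, t', e'⟩ := hsome n hn
    rw [e'] at e
    simp at e
  simp only [advance, h₀, hB, if_true, hbody]
  rw [dif_pos hex, hfind]

theorem advance_of_diverging {ρ b : Run I} {s : State I} {o : I.D} {g : Mech Ag V F R}
    (h₀ : ρ 0 = some (some g, s)) (hB : B.holds I s)
    (hb : ∀ n, ∃ g s, b n = some (some g, s))
    (hρ : ∀ n, ρ (n + 1) = (b n).map (liftCfg I (.wh B γ))) :
    advance B OH (ρ, o) = ((fun _ => none), OH (s, o) b) := by
  have hbody : bodyRun I (fun n => ρ (n + 1)) = b := by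
    refine bodyRun_eq (B := B) (γ := γ) (fun n _ => hρ n) ?_
    intro m n _ hm
    obtain ⟨g, t, e⟩ := hb m
    exact absurd e (hm g t)
  simp only [advance, h₀, hB, if_true, hbody]
  rw [dif_neg]
  rintro ⟨m, t, e⟩
  obtain ⟨g, t', e'⟩ := hb m
  rw [e'] at e
  simp at e

theorem Boundary.exists_last (h : Boundary γ B OH so₀ k H so) :
    ∃ p, H = p ++ [(some (.wh B γ), so.1)] := by
  cases h with
  | base => exact ⟨[], rfl⟩
  | step h hB hh => exact ⟨_, by rw [List.map_append, ← List.append_assoc]; rfl⟩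

theorem Boundary.advance_iterate (h : Boundary γ B OH so₀ k H so) {ρ : Run I}
    (hρ : ∀ n < H.length, ρ n = H[n]?) :
    (advance B OH)^[k] (ρ, so₀.2) = ((fun n => ρ (n + (H.length - 1))), so.2) := by
  induction h with
  | base => rfl
  | @step k H so hb s' h hB hh ih =>
    obtain ⟨p, hp⟩ := h.exists_last
    have hlen : H.length = p.length + 1 := by simp [hp]
    rw [Function.iterate_succ_apply', ih, advance_of_terminated (g := .wh B γ) (hb := hb) (s' := s') _
      hB hh.fst_ne_none]
    · simp only [Prod.mk.injEq, and_true]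
      funext n
      congr 1
      simp
      omega
    · intro n hn
      rw [hρ _ (by simp; omega), List.getElem?_append_right (by omega)]
      congr 1
      omega
    · rw [hρ _ (by simp; omega), List.getElem?_append_left (by omega)]
      simp [hp]
    · intro n hn
      rw [hρ n (by simp; omega), List.getElem?_append_left hn]

theorem foldl_trackStep_live (hlive : ∀ d ∈ hb, d.1 ≠ none) (so : State I × I.D)
    (l : List (Cfg I)) :
    (hb.map (liftCfg I (.wh B γ))).foldl (trackStep OH) (so, l) = (so, l ++ hb) := by
  induction hb generalizing l with
  | nil => simp
  | cons c t ih =>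
    rcases c with ⟨_ | g, s⟩
    · exact absurd rfl (hlive _ List.mem_cons_self)
    · rw [List.map_cons, List.foldl_cons]
      simp only [liftCfg, trackStep]
      rw [ih fun d hd => hlive d (List.mem_cons_of_mem _ hd)]
      simp

theorem Boundary.foldl_trackStep (h : Boundary γ B OH so₀ k H so) :
    H.tail.foldl (trackStep OH) (so₀, []) = (so, []) := by
  induction h with
  | base => rfl
  | @step k H so hb s' h hB hh ih =>
    obtain ⟨p, hp⟩ := h.exists_last
    rw [List.tail_append_of_ne_nil (by simp [hp]), List.foldl_append, ih, List.map_append,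
      List.foldl_append, foldl_trackStep_live hh.fst_ne_none]
    simp [liftCfg, trackStep]

theorem Boundary.loopProfile_apply (h : Boundary γ B OH so₀ k H so)
    (hlive : ∀ d ∈ hb, d.1 ≠ none) (a : Ag) :
    loopProfile OH SG so₀ a (H ++ hb.map (liftCfg I (.wh B γ))) = SG so a hb := by
  obtain ⟨p, hp⟩ := h.exists_last
  unfold loopProfile
  rw [List.tail_append_of_ne_nil (by simp [hp]), List.foldl_append, h.foldl_trackStep,
    foldl_trackStep_live hlive, List.nil_append]

theorem Boundary.mem (h : Boundary γ B OH so₀ k H so)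
    (hO : ∀ so ∈ gate I B P, memOhat I (some γ, so.1) P (OH so)) (h₀ : so₀ ∈ P) : so ∈ P := by
  induction h with
  | base => exact h₀
  | step h hB hh ih => exact memOhat_iff.mp (hO _ ⟨ih, hB⟩) _ _ hh

/-- Every history of the loop consists of complete rounds followed by an initial part of a round
or by the exit from the loop. -/
theorem IsHist.exists_boundary {h : List (Cfg I)} (hh : IsHist I (some (.wh B γ), so₀.1) h) :
    ∃ k H so, Boundary γ B OH so₀ k H so ∧ (h = H ∨ (¬ B.holds I so.1 ∧ h = H ++ [(none, so.1)]) ∨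
      (B.holds I so.1 ∧ ∃ hb, IsHist I (some γ, so.1) hb ∧ (∀ d ∈ hb, d.1 ≠ none) ∧
        h = H ++ hb.map (liftCfg I (.wh B γ)))) := by
  refine IsHist.rec_concat (motive := fun h => ∃ k H so, Boundary γ B OH so₀ k H so ∧
    (h = H ∨ (¬ B.holds I so.1 ∧ h = H ++ [(none, so.1)]) ∨
      (B.holds I so.1 ∧ ∃ hb, IsHist I (some γ, so.1) hb ∧ (∀ d ∈ hb, d.1 ≠ none) ∧
        h = H ++ hb.map (liftCfg I (.wh B γ))))) ⟨_, _, _, .base, Or.inl rfl⟩ ?_ hh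
  rintro l c d - ⟨L, hs⟩ ⟨k, H, so, hH, e | ⟨-, e⟩ | ⟨hB, hb, hhb, hlive, e⟩⟩
  · obtain ⟨p, hp⟩ := hH.exists_last
    obtain ⟨-, hc⟩ := List.append_inj' (e.trans hp) rfl
    obtain rfl : c = (some (.wh B γ), so.1) := by simpa using hc
    refine ⟨k, H, so, hH, Or.inr ?_⟩
    cases hs with
    | whF hB => exact Or.inl ⟨hB, by rw [e]⟩
    | whT hB => exact Or.inr ⟨hB, _, isHist_singleton, by simp, by rw [e]; rfl⟩
  · obtain ⟨-, hc⟩ := List.append_inj' e rfl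
    obtain rfl : c = (none, so.1) := by simpa using hc
    cases hs
  · rcases List.eq_nil_or_concat hb with rfl | ⟨q, ⟨_ | g, s⟩, rfl⟩
    · exact absurd rfl hhb.ne_nil
    · exact absurd rfl (hlive (none, s) (by simp))
    · rw [List.concat_eq_append] at *
      rw [List.map_append, ← List.append_assoc] at e
      obtain ⟨-, hc⟩ := List.append_inj' e rfl
      obtain rfl : c = (some (.seq g (.wh B γ)), s) := by simpa [liftCfg] using hc
      rw [e]
      cases hs with
      | seqFin hs =>
        refine ⟨k + 1, _, _, hH.step hB (isHist_concat_concat.mpr ⟨hhb, _, hs⟩), Or.inl ?_⟩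
        simp [liftCfg]
      | seqStep hs =>
        refine ⟨k, H, so, hH, Or.inr (Or.inr ⟨hB, _, isHist_concat_concat.mpr ⟨hhb, _, hs⟩, ?_, ?_⟩)⟩
        · intro d hd
          rcases List.mem_append.mp hd with hd | hd
          · exact hlive d hd
          · simp [List.mem_singleton.mp hd]
        · simp [liftCfg]

/-- The profile `τb` of the body plays like the profile `τ` of the loop does in the round that
starts after the history `H`. -/
def PlaysLike (γ : Mech Ag V F R) (B : BExp V F R) (H : List (Cfg I)) (τ τb : Profile I) : Prop :=
  ∀ a l, (∀ d ∈ l, d.1 ≠ none) → τb a l = τ a (H ++ l.map (liftCfg I (.wh B γ)))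

theorem PlaysLike.extend {τ τb : Profile I} (e : PlaysLike γ B H τ τb) (hne : hb ≠ [])
    (hlive : ∀ d ∈ hb, d.1 ≠ none) :
    extend I τ (H ++ hb.map (liftCfg I (.wh B γ))) =
      H ++ (MPL.extend I τb hb).map (liftCfg I (.wh B γ)) := by
  rcases List.eq_nil_or_concat hb with rfl | ⟨q, ⟨_ | g, s⟩, rfl⟩
  · exact absurd rfl hne
  · exact absurd rfl (hlive (none, s) (by simp))
  · rw [List.concat_eq_append] at *
    have hn := next_congr (fun a => e a _ hlive) g s
    rw [List.map_append, ← List.append_assoc] at hn ⊢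
    simp only [List.map_cons, List.map_nil, liftCfg] at hn ⊢
    rw [extend_concat_some, extend_concat_some]
    simp only [next, ← hn]
    rcases next I τb (q ++ [(some g, s)]) g s with ⟨_ | g', s'⟩ <;> simp [liftCfg]

theorem PlaysLike.iterate_extend {τ τb : Profile I} (e : PlaysLike γ B H τ τb) (hne : hb ≠ [])
    {m : ℕ} (hlive : ∀ j < m, ∀ d ∈ (MPL.extend I τb)^[j] hb, d.1 ≠ none) :
    (MPL.extend I τ)^[m] (H ++ hb.map (liftCfg I (.wh B γ))) =
      H ++ ((MPL.extend I τb)^[m] hb).map (liftCfg I (.wh B γ)) := by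
  induction m with
  | zero => rfl
  | succ m ih =>
    rw [Function.iterate_succ_apply', Function.iterate_succ_apply',
      ih fun j hj => hlive j (by omega),
      e.extend (iterate_extend_ne_nil hne m) (hlive m (by omega))]

theorem Boundary.extend_of_holds (h : Boundary γ B OH so₀ k H so) (hB : B.holds I so.1)
    (τ : Profile I) :
    extend I τ H = H ++ [((some γ, so.1) : Cfg I)].map (liftCfg I (.wh B γ)) := by
  obtain ⟨p, rfl⟩ := h.exists_last
  rw [extend_concat_some]
  simp [next, hB, liftCfg]

/-- The effect of completing the current round of the loop. -/
theorem Boundary.advance_contRun (h : Boundary γ B OH so₀ k H so) (hB : B.holds I so.1)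
    (hhb : IsHist I (some γ, so.1) hb) {τ τb : Profile I}
    (e : PlaysLike γ B H τ τb) {ρ : Run I}
    (hρ : ρ = contRun I τ (H ++ hb.map (liftCfg I (.wh B γ)))) :
    (∀ j, ((advance B OH)^[k + 1 + j] (ρ, so₀.2)).2 = OH so (contRun I τb hb)) ∨
      ∃ H' s', Boundary γ B OH so₀ (k + 1) H' (s', OH so (contRun I τb hb)) ∧
        ρ = contRun I τ H' := by
  have hne := hhb.ne_nil
  by_cases hfin : ∃ m, ¬ ∀ d ∈ (extend I τb)^[m] hb, d.1 ≠ none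
  · right
    have hit := e.iterate_extend hne (m := Nat.find hfin) fun j hj =>
      not_not.mp (Nat.find_min hfin hj)
    have hspec := Nat.find_spec hfin
    have hhist := hhb.iterate_extend (σ := τb) (Nat.find hfin)
    rcases List.eq_nil_or_concat ((extend I τb)^[Nat.find hfin] hb) with e' | ⟨q, ⟨g, s'⟩, e'⟩
    · exact absurd e' (iterate_extend_ne_nil hne _)
    · rw [List.concat_eq_append] at e'
      rw [e'] at hspec hhist hit
      obtain rfl : g = none := by
        by_contra hg
        apply hspec
        intro d hd
        rcases List.mem_append.mp hd with hd | hd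
        · exact hhist.fst_ne_none d hd
        · rw [List.mem_singleton.mp hd]
          exact hg
      refine ⟨H ++ (q ++ [(none, s')]).map (liftCfg I (.wh B γ)), s', ?_, ?_⟩
      · rw [← contRun_iterate_extend hne (Nat.find hfin), e', contRun_concat_none]
        exact h.step hB hhist
      · rw [hρ, ← hit, contRun_iterate_extend (by simp [hne])]
  · left
    push Not at hfin
    have hit : ∀ m, (extend I τ)^[m] (H ++ hb.map (liftCfg I (.wh B γ))) =
        H ++ ((extend I τb)^[m] hb).map (liftCfg I (.wh B γ)) := fun m =>
      e.iterate_extend hne fun j _ => hfin j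
    obtain ⟨p, hp⟩ := h.exists_last
    have hlen : H.length = p.length + 1 := by simp [hp]
    have hpre : ∀ n < H.length, ρ n = H[n]? := by
      intro n hn
      rw [hρ, contRun_of_lt (by simp; omega), List.getElem?_append_left hn]
    have hlow : ∀ n, ρ (n + H.length) = (contRun I τb hb n).map (liftCfg I (.wh B γ)) := by
      intro n
      apply Option.ext
      intro c
      rw [hρ, contRun_eq_some_iff (by simp [hne]), Option.map_eq_some_iff]
      simp only [hit, List.getElem?_append_right (Nat.le_add_left _ _), Nat.add_sub_cancel,
        List.getElem?_map, Option.map_eq_some_iff, contRun_eq_some_iff hne]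
      constructor
      · rintro ⟨m, a, h1, h2⟩
        exact ⟨a, ⟨m, h1⟩, h2⟩
      · rintro ⟨a, ⟨m, h1⟩, h2⟩
        exact ⟨m, a, h1, h2⟩
    have hsome : ∀ n, ∃ g s, contRun I τb hb n = some (some g, s) := by
      intro n
      have hlt : n < ((extend I τb)^[n] hb).length := by
        rcases iterate_extend_stuck_or (σ := τb) hb hne n with e' | hl
        · exfalso
          rcases List.eq_nil_or_concat ((extend I τb)^[n] hb) with e'' | ⟨q, ⟨_ | g, s⟩, e''⟩
          · exact iterate_extend_ne_nil hne _ e''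
          · exact hfin n (none, s) (by rw [e'']; simp) rfl
          · rw [List.concat_eq_append] at e''
            rw [e'', extend_concat_some] at e'
            simpa using congrArg List.length e'
        · exact hl
      obtain ⟨g, hg⟩ := Option.ne_none_iff_exists'.mp (hfin n _ (List.getElem_mem hlt))
      refine ⟨g, (((extend I τb)^[n] hb)[n]).2, ?_⟩
      rw [contRun, List.getElem?_eq_getElem hlt, ← hg]
    have hadv : (advance B OH)^[k + 1] (ρ, so₀.2) =
        ((fun _ => none), OH so (contRun I τb hb)) := by
      rw [Function.iterate_succ_apply', h.advance_iterate hpre]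
      refine advance_of_diverging (γ := γ) (g := .wh B γ) ?_ hB hsome ?_
      · rw [hpre _ (by omega)]
        simp [hp]
      · intro n
        rw [← hlow]
        congr 1
        omega
    intro j
    rw [Nat.add_comm, Function.iterate_add_apply, hadv, Function.iterate_fixed (advance_none _)]

theorem Boundary.advance_iterate_of_not_holds (h : Boundary γ B OH so₀ k H so)
    (hB : ¬ B.holds I so.1) {ρ : Run I} (hρ : ∀ n < H.length, ρ n = H[n]?) (j : ℕ) :
    ((advance B OH)^[k + j] (ρ, so₀.2)).2 = so.2 := by
  obtain ⟨p, hp⟩ := h.exists_last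
  rw [Nat.add_comm, Function.iterate_add_apply, h.advance_iterate hρ, Function.iterate_fixed]
  refine advance_of_not_holds (g := .wh B γ) ?_ hB
  rw [hρ _ (by simp [hp])]
  simp [hp]

/-- If `r` relates the promised outcome at the start of each round to the outcome of that round
under `τ`, then it relates the promised outcome to all later ones. -/
theorem Boundary.rel_iterate {r : I.D → I.D → Prop} (hrefl : ∀ d, r d d)
    (htrans : ∀ a b c, r a b → r b c → r a c) {τ : Profile I}
    (hτ : ∀ k H so, Boundary γ B OH so₀ k H so → B.holds I so.1 → ∃ τb, PlaysLike γ B H τ τb ∧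
      r so.2 (OH so (contRun I τb [(some γ, so.1)])))
    (j : ℕ) (h : Boundary γ B OH so₀ k H so) :
    r so.2 ((advance B OH)^[k + j] (contRun I τ H, so₀.2)).2 := by
  induction j generalizing k H so with
  | zero =>
    rw [Nat.add_zero, h.advance_iterate fun n hn => contRun_of_lt hn]
    exact hrefl _
  | succ j ih =>
    by_cases hB : B.holds I so.1
    · obtain ⟨τb, hlike, hr⟩ := hτ k H so h hB
      obtain ⟨p, hp⟩ := h.exists_last
      have hcont : contRun I τ H = contRun I τ (H ++ [((some γ, so.1) : Cfg I)].map
          (liftCfg I (.wh B γ))) := by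
        rw [← h.extend_of_holds hB τ, contRun_extend (by simp [hp])]
      have hk : k + (j + 1) = k + 1 + j := by omega
      rcases h.advance_contRun hB isHist_singleton hlike hcont with e | ⟨H', s', h', e⟩
      · rw [hk, e]
        exact hr
      · rw [hk, e]
        exact htrans _ _ _ hr (ih h')
    · rw [h.advance_iterate_of_not_holds hB fun n hn => contRun_of_lt hn]
      exact hrefl _

theorem Boundary.rel_iterate_of_round {r : I.D → I.D → Prop} (hrefl : ∀ d, r d d)
    (htrans : ∀ a b c, r a b → r b c → r a c) {τ τb : Profile I}
    (hτ : ∀ k H so, Boundary γ B OH so₀ k H so → B.holds I so.1 → ∃ τb, PlaysLike γ B H τ τb ∧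
      r so.2 (OH so (contRun I τb [(some γ, so.1)])))
    (h : Boundary γ B OH so₀ k H so) (hB : B.holds I so.1) (hhb : IsHist I (some γ, so.1) hb)
    (e : PlaysLike γ B H τ τb) (j : ℕ) :
    r (OH so (contRun I τb hb)) ((advance B OH)^[k + 1 + j]
      (contRun I τ (H ++ hb.map (liftCfg I (.wh B γ))), so₀.2)).2 := by
  rcases h.advance_contRun hB hhb e rfl with e | ⟨H', s', h', e⟩
  · rw [e]
    exact hrefl _
  · rw [e]
    exact h'.rel_iterate hrefl htrans hτ j

theorem loopOutcome_eq {ρ : Run I} {o₀ v : I.D} (N : ℕ)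
    (hv : ∀ j, v = ((advance B OH)^[N + j] (ρ, o₀)).2) : loopOutcome B OH o₀ ρ = v := by
  have hex : ∃ d N, ∀ n ≥ N, ((advance B OH)^[n] (ρ, o₀)).2 = d := by
    refine ⟨v, N, fun n hn => ?_⟩
    obtain ⟨j, rfl⟩ := Nat.exists_eq_add_of_le hn
    exact (hv j).symm
  unfold loopOutcome
  rw [dif_pos hex]
  obtain ⟨N', hN'⟩ := hex.choose_spec
  rw [← hN' (N + N') (by omega), ← hv N']

theorem pref_loopOutcome {ρ : Run I} {o₀ v : I.D} {i : Ag} (N : ℕ)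
    (hv : ∀ j, I.pref i v ((advance B OH)^[N + j] (ρ, o₀)).2) :
    I.pref i v (loopOutcome B OH o₀ ρ) := by
  by_cases hex : ∃ d N, ∀ n ≥ N, ((advance B OH)^[n] (ρ, o₀)).2 = d
  · obtain ⟨d, N', hd⟩ := hex
    have hd' : ∀ j, ((advance B OH)^[N' + j] (ρ, o₀)).2 = d := fun j => hd _ (by omega)
    rw [loopOutcome_eq N' fun j => (hd' j).symm, ← hd (N + N') (by omega)]
    exact hv N'
  · unfold loopOutcome
    rw [dif_neg hex]
    exact I.worst_least i v

theorem Boundary.playsLike_loopProfile (h : Boundary γ B OH so₀ k H so) :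
    PlaysLike γ B H (loopProfile OH SG so₀) (SG so) :=
  fun a _ hl => (h.loopProfile_apply hl a).symm

theorem Boundary.exists_playsLike (h : Boundary γ B OH so₀ k H so) {i : Ag} {τ : Profile I}
    (hτ : ∀ j, j ≠ i → τ j = loopProfile OH SG so₀ j) :
    ∃ τb, (∀ j, j ≠ i → τb j = SG so j) ∧ PlaysLike γ B H τ τb := by
  refine ⟨fun j => if j = i then fun l => τ i (H ++ l.map (liftCfg I (.wh B γ))) else SG so j,
    fun j hj => if_neg hj, ?_⟩
  intro a l hl
  by_cases ha : a = i
  · subst ha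
    simp
  · simp only [if_neg ha]
    rw [hτ a ha, h.loopProfile_apply hl]

theorem memOhat_loopOutcome (hO : ∀ so ∈ gate I B P, memOhat I (some γ, so.1) P (OH so))
    (h₀ : so₀ ∈ P) :
    memOhat I (some (.wh B γ), so₀.1) (gateN I B P) (loopOutcome B OH so₀.2) := by
  rw [memOhat_iff]
  intro h s hh
  obtain ⟨k, H, so, hH, e | ⟨hB, e⟩ | ⟨-, hb, hhb, hlive, e⟩⟩ := hh.exists_boundary (OH := OH)
  · obtain ⟨p, hp⟩ := hH.exists_last
    have := (List.append_inj' (e.trans hp) rfl).2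
    simp at this
  · obtain ⟨rfl, hs⟩ := List.append_inj' e rfl
    obtain rfl : s = so.1 := by simpa using hs
    rw [loopOutcome_eq (v := so.2) k]
    · exact ⟨hH.mem hO h₀, hB⟩
    · intro j
      refine (hH.advance_iterate_of_not_holds hB ?_ j).symm
      intro n hn
      simp only [listRun]
      rw [List.getElem?_append_left hn]
  · rcases List.eq_nil_or_concat hb with rfl | ⟨q, ⟨_ | g, t⟩, rfl⟩
    · exact absurd rfl hhb.ne_nil
    · exact absurd rfl (hlive (none, t) (by simp))
    · rw [List.concat_eq_append, List.map_append, ← List.append_assoc] at e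
      have := (List.append_inj' e rfl).2
      simp [liftCfg] at this

theorem Boundary.exists_playsLike_eq (hP : ∀ so ∈ gate I B P,
      memOhat I (some γ, so.1) P (OH so) ∧ OH so (runOf I (some γ, so.1) (SG so)) = so.2)
    (h₀ : so₀ ∈ P) (h : Boundary γ B OH so₀ k H so) (hB : B.holds I so.1) :
    ∃ τb, PlaysLike γ B H (loopProfile OH SG so₀) τb ∧
      so.2 = OH so (contRun I τb [(some γ, so.1)]) := by
  refine ⟨SG so, h.playsLike_loopProfile, ?_⟩
  rw [← runOf_eq_contRun]
  exact (hP so ⟨h.mem (fun so hso => (hP so hso).1) h₀, hB⟩).2.symm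

theorem spe_loopProfile (hP : ∀ so ∈ gate I B P, memOhat I (some γ, so.1) P (OH so) ∧
      OH so (runOf I (some γ, so.1) (SG so)) = so.2)
    (hS : ∀ so ∈ gate I B P, SPE I γ so.1 (OH so) (SG so)) (h₀ : so₀ ∈ P) :
    SPE I (.wh B γ) so₀.1 (loopOutcome B OH so₀.2) (loopProfile OH SG so₀) := by
  rw [spe_iff]
  intro h hh i τ hτ
  have hmem : ∀ {k H so}, Boundary γ B OH so₀ k H so → B.holds I so.1 → so ∈ gate I B P :=
    fun h hB => ⟨h.mem (fun so hso => (hP so hso).1) h₀, hB⟩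
  have hround : ∀ k H so, Boundary γ B OH so₀ k H so → B.holds I so.1 →
      ∃ τb, PlaysLike γ B H τ τb ∧ I.pref i so.2 (OH so (contRun I τb [(some γ, so.1)])) := by
    intro k H so hH hB
    obtain ⟨τb, hdev, hlike⟩ := hH.exists_playsLike hτ
    refine ⟨τb, hlike, ?_⟩
    have hval := (hP so (hmem hH hB)).2
    rw [runOf_eq_contRun] at hval
    have := spe_iff.mp (hS so (hmem hH hB)) _ isHist_singleton i τb hdev
    rwa [hval] at this
  have hinside : ∀ {k H so hb}, Boundary γ B OH so₀ k H so → B.holds I so.1 →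
      IsHist I (some γ, so.1) hb → 
      I.pref i
        (loopOutcome B OH so₀.2
          (contRun I (loopProfile OH SG so₀) (H ++ hb.map (liftCfg I (.wh B γ)))))
        (loopOutcome B OH so₀.2 (contRun I τ (H ++ hb.map (liftCfg I (.wh B γ))))) := by
    intro k H so hb hH hB hhb
    obtain ⟨τb, hdev, hlike⟩ := hH.exists_playsLike hτ
    rw [loopOutcome_eq (k + 1) (hH.rel_iterate_of_round (r := Eq) (fun _ => rfl)
      (fun _ _ _ => Eq.trans) (fun _ _ _ => Boundary.exists_playsLike_eq hP h₀) hB hhb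
      hH.playsLike_loopProfile)]
    refine I.pref_trans _ _ _ _ (spe_iff.mp (hS so (hmem hH hB)) _ hhb i τb hdev) ?_
    exact pref_loopOutcome (k + 1) (hH.rel_iterate_of_round (I.pref_refl i) (I.pref_trans i)
      hround hB hhb hlike)
  obtain ⟨k, H, so, hH, e | ⟨hB, e⟩ | ⟨hB, hb, hhb, -, e⟩⟩ := hh.exists_boundary (OH := OH)
  · obtain ⟨p, hp⟩ := hH.exists_last
    subst e
    by_cases hB : B.holds I so.1
    · have hne : h ≠ [] := by simp [hp]
      rw [← contRun_extend hne, ← contRun_extend (σ := τ) hne, hH.extend_of_holds hB,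
        hH.extend_of_holds hB]
      exact hinside hH hB isHist_singleton
    · rw [loopOutcome_eq k fun j =>
          (hH.advance_iterate_of_not_holds hB (fun n hn => contRun_of_lt hn) j).symm,
        loopOutcome_eq k fun j =>
          (hH.advance_iterate_of_not_holds hB (fun n hn => contRun_of_lt hn) j).symm]
      exact I.pref_refl i _
  · rw [e, contRun_concat_none, contRun_concat_none]
    exact I.pref_refl i _
  · rw [e]
    exact hinside hH hB hhb

theorem loopOutcome_loopProfile (hP : ∀ so ∈ gate I B P, memOhat I (some γ, so.1) P (OH so) ∧
      OH so (runOf I (some γ, so.1) (SG so)) = so.2) (h₀ : so₀ ∈ P) :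
    loopOutcome B OH so₀.2 (runOf I (some (.wh B γ), so₀.1) (loopProfile OH SG so₀)) = so₀.2 := by
  rw [runOf_eq_contRun]
  exact loopOutcome_eq 0 fun j => Boundary.base.rel_iterate (r := Eq) (fun _ => rfl)
    (fun _ _ _ => Eq.trans) (fun _ _ _ => Boundary.exists_playsLike_eq hP h₀) j

end Loop

end MPL

open MPL in
/-- Iteration Lemma: if `I ⊨ {P ∩ B^I}γ{P}` then `I ⊨ {P} while B do γ {P ∩ (¬B)^I}`. -/
theorem iteration_lemma {Ag V F R : Type} (I : Interp Ag V F R)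
    (γ : Mech Ag V F R) (B : BExp V F R) (P : EPred I)
    (h : Valid I (gate I B P) γ P) :
    Valid I P (Mech.wh B γ) (gateN I B P) := by
  have hchoice : ∀ so, ∃ (oh : OutcomeF I) (σ : Profile I), so ∈ gate I B P →
      memOhat I (some γ, so.1) P oh ∧ SPE I γ so.1 oh σ ∧
        oh (runOf I (some γ, so.1) σ) = so.2 := by
    intro so
    by_cases hso : so ∈ gate I B P
    · obtain ⟨oh, σ, hspec⟩ := h so hso
      exact ⟨oh, σ, fun _ => hspec⟩
    · exact ⟨fun _ => I.worst, fun _ _ => I.worst, fun hc => absurd hc hso⟩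
  choose OH SG hspec using hchoice
  have hP : ∀ so ∈ gate I B P, memOhat I (some γ, so.1) P (OH so) ∧
      OH so (runOf I (some γ, so.1) (SG so)) = so.2 :=
    fun so hso => ⟨(hspec so hso).1, (hspec so hso).2.2⟩
  intro so hso
  exact ⟨loopOutcome B OH so.2, loopProfile OH SG so,
    memOhat_loopOutcome (fun so hso => (hP so hso).1) hso,
    spe_loopProfile hP (fun so hso => (hspec so hso).2.1) hso, loopOutcome_loopProfile hP hso⟩
end
end

section
/- (Soundness Theorem) For every interpretation I, mechanism γ, and e-predicates P, Q: if I ⊢ {P}γ{Q} (the assertion is derivable in the Hoare-style calculus for mechanisms), then I ⊨ {P}γ{Q}. -/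
open scoped Classical

noncomputable section

namespace MPL

variable {I : Interp Ag V F R}

/-! ### One step of play -/

/-- The successor of `⟨γ,s⟩` when every agent `a` picks the value `x a`. -/
def play (I : Interp Ag V F R) (x : Ag → I.D) (γ : Mech Ag V F R) (s : State I) : Cfg I :=
  next I (fun a _ => x a) [] γ s

/-- Replace `Λ` by `γ2` and every other mechanism `γ'` by `γ';γ2`. -/
def seqLift (γ2 : Mech Ag V F R) : Cfg I → Cfg I
  | (none, s) => (some γ2, s)
  | (some γ', s) => (some (.seq γ' γ2), s)

theorem seqLift_injective (γ2 : Mech Ag V F R) :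
    Function.Injective (seqLift γ2 : Cfg I → Cfg I) := by
  have hne : ∀ γ' : Mech Ag V F R, Mech.seq γ' γ2 ≠ γ2 := by
    intro γ' h
    have := congrArg sizeOf h
    simp at this
  rintro ⟨_ | γ', s⟩ ⟨_ | γ'', s'⟩ h
  · simpa [seqLift] using h
  · simp only [seqLift, Prod.mk.injEq, Option.some.injEq] at h
    exact absurd h.1.symm (hne _)
  · simp only [seqLift, Prod.mk.injEq, Option.some.injEq] at h
    exact absurd h.1 (hne _)
  · simpa [seqLift] using h

theorem next_seq (σ : Profile I) (h : List (Cfg I)) (γ1 γ2 : Mech Ag V F R) (s : State I) :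
    next I σ h (.seq γ1 γ2) s = seqLift γ2 (next I σ h γ1 s) := by
  rw [next]
  rcases next I σ h γ1 s with ⟨_ | γ', s'⟩ <;> rfl

theorem next_eq_play (σ : Profile I) (h : List (Cfg I)) (γ : Mech Ag V F R) (s : State I) :
    next I σ h γ s = play I (fun a => σ a h) γ s := by
  induction γ with
  | seq γ1 γ2 ih1 _ => rw [play, next_seq, next_seq, ih1, play]
  | _ => rfl

theorem play_seq (x : Ag → I.D) (γ1 γ2 : Mech Ag V F R) (s : State I) :
    play I x (.seq γ1 γ2) s = seqLift γ2 (play I x γ1 s) :=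
  next_seq _ _ _ _ _

theorem Step.exists_play {c c' : Cfg I} {L : Set Ag} (hs : Step I c L c') :
    ∃ γ, c.1 = some γ ∧ ∃ x, c' = play I x γ c.2 := by
  induction hs with
  | assign x t s => exact ⟨_, rfl, fun _ => I.worst, rfl⟩
  | choice A hA X hX s s' hagree =>
    refine ⟨_, rfl, fun a => s' (X a), Prod.ext rfl (funext fun y => ?_)⟩
    simp only [play, next, chooseVal]
    split_ifs with hy
    · rw [hy.choose_spec.2]
    · exact hagree y fun a ha hay => hy ⟨a, ha, hay⟩
  | seqFin _ ih =>
    obtain ⟨_, hγ, x, hx⟩ := ih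
    cases hγ
    exact ⟨_, rfl, x, by rw [play_seq, ← hx]; rfl⟩
  | seqStep _ ih =>
    obtain ⟨_, hγ, x, hx⟩ := ih
    cases hγ
    exact ⟨_, rfl, x, by rw [play_seq, ← hx]; rfl⟩
  | iteT hB => exact ⟨_, rfl, fun _ => I.worst, by simp [play, next, hB]⟩
  | iteF hB => exact ⟨_, rfl, fun _ => I.worst, by simp [play, next, hB]⟩
  | whF hB => exact ⟨_, rfl, fun _ => I.worst, by simp [play, next, hB]⟩
  | whT hB => exact ⟨_, rfl, fun _ => I.worst, by simp [play, next, hB]⟩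

/-! ### Promises: a local characterization of equilibrium outcomes -/

/-- At `⟨γ,s⟩` the choices `x` are a one-shot equilibrium with value `o`, when the continuation
from a successor `c` is worth `v c`; all successors are admitted by `W` with these values. -/
structure LocalEq (W : Cfg I → I.D → Prop) (γ : Mech Ag V F R) (s : State I) (o : I.D)
    (x : Ag → I.D) (v : Cfg I → I.D) : Prop where
  succ : ∀ y, W (play I y γ s) (v (play I y γ s))
  value : v (play I x γ s) = o
  stable : ∀ i y, (∀ j, j ≠ i → y j = x j) → I.pref i o (v (play I y γ s))

/-- A relation between configurations and promised outcomes which can be kept forever by local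
equilibria, and which lies inside `Q` at terminal configurations. -/
structure Consistent (W : Cfg I → I.D → Prop) (Q : EPred I) : Prop where
  final : ∀ s o, W (none, s) o → (s, o) ∈ Q
  step : ∀ γ s o, W (some γ, s) o → ∃ x v, LocalEq W γ s o x v

/-- Every pair in `P` can be promised at the start of `γ`, consistently with `Q`. -/
def Promises (I : Interp Ag V F R) (P : EPred I) (γ : Mech Ag V F R) (Q : EPred I) : Prop :=
  ∃ W : Cfg I → I.D → Prop, Consistent W Q ∧ ∀ s o, (s, o) ∈ P → W (some γ, s) o

theorem LocalEq.mono {W W' : Cfg I → I.D → Prop} {γ : Mech Ag V F R} {s : State I} {o : I.D}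
    {x : Ag → I.D} {v : Cfg I → I.D} (h : LocalEq W γ s o x v) (hW : ∀ c d, W c d → W' c d) :
    LocalEq W' γ s o x v :=
  ⟨fun y => hW _ _ (h.succ y), h.value, h.stable⟩

theorem LocalEq.of_forced {W : Cfg I → I.D → Prop} {γ : Mech Ag V F R} {s : State I} {o : I.D}
    {c : Cfg I} (hc : ∀ x, play I x γ s = c) (hW : W c o) :
    LocalEq W γ s o (fun _ => I.worst) (fun _ => o) :=
  ⟨fun y => by rwa [hc y], rfl, fun i _ _ => I.pref_refl i o⟩

theorem LocalEq.seq {W W' : Cfg I → I.D → Prop} {γ1 γ2 : Mech Ag V F R} {s : State I} {o : I.D}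
    {x : Ag → I.D} {v : Cfg I → I.D} (h : LocalEq W γ1 s o x v)
    (hW : ∀ c d, W c d → W' (seqLift γ2 c) d) :
    LocalEq W' (.seq γ1 γ2) s o x (Function.extend (seqLift γ2) v fun _ => I.worst) := by
  refine ⟨fun y => ?_, ?_, fun i y hy => ?_⟩ <;>
    rw [play_seq, (seqLift_injective γ2).extend_apply]
  · exact hW _ _ (h.succ y)
  · exact h.value
  · exact h.stable i y hy

theorem Promises.assign (Q : EPred I) (x : V) (t : Term V F) :
    Promises I (substPred I Q x t) (.assign x t) Q := by
  refine ⟨fun c d => (c.1 = some (.assign x t) ∧ (c.2, d) ∈ substPred I Q x t) ∨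
    (c.1 = none ∧ (c.2, d) ∈ Q), ⟨?_, ?_⟩, fun s o h => Or.inl ⟨rfl, h⟩⟩
  · rintro s o (⟨h, _⟩ | ⟨_, h⟩)
    · cases h
    · exact h
  · rintro γ s o (⟨h, hP⟩ | ⟨h, _⟩)
    · cases h
      exact ⟨_, _, .of_forced (c := (none, updState I s x (t.eval I s))) (fun _ => rfl)
        (Or.inr ⟨rfl, hP⟩)⟩
    · cases h

theorem Promises.comp {P Q' Q : EPred I} {γ1 γ2 : Mech Ag V F R}
    (h1 : Promises I P γ1 Q') (h2 : Promises I Q' γ2 Q) : Promises I P (.seq γ1 γ2) Q := by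
  obtain ⟨W1, hW1, hP1⟩ := h1
  obtain ⟨W2, hW2, hP2⟩ := h2
  refine ⟨fun c d => (∃ γ', c.1 = some (.seq γ' γ2) ∧ W1 (some γ', c.2) d) ∨ W2 c d, ⟨?_, ?_⟩,
    fun s o h => Or.inl ⟨γ1, rfl, hP1 s o h⟩⟩
  · rintro s o (⟨_, h, _⟩ | h)
    · cases h
    · exact hW2.final s o h
  · rintro γ s o (⟨γ', h, hW⟩ | h)
    · cases h
      obtain ⟨x, v, hl⟩ := hW1.step γ' s o hW
      refine ⟨_, _, hl.seq ?_⟩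
      rintro ⟨_ | γ'', s'⟩ d hd
      · exact Or.inr (hP2 s' d (hW1.final s' d hd))
      · exact Or.inl ⟨γ'', rfl, hd⟩
    · obtain ⟨x, v, hl⟩ := hW2.step γ s o h
      exact ⟨x, v, hl.mono fun _ _ => Or.inr⟩

theorem Promises.ite {P Q : EPred I} {B : BExp V F R} {γ1 γ2 : Mech Ag V F R}
    (h1 : Promises I (gate I B P) γ1 Q) (h2 : Promises I (gateN I B P) γ2 Q) :
    Promises I P (.ite B γ1 γ2) Q := by
  obtain ⟨W1, hW1, hP1⟩ := h1
  obtain ⟨W2, hW2, hP2⟩ := h2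
  refine ⟨fun c d => (c.1 = some (.ite B γ1 γ2) ∧ (c.2, d) ∈ P) ∨ W1 c d ∨ W2 c d, ⟨?_, ?_⟩,
    fun s o h => Or.inl ⟨rfl, h⟩⟩
  · rintro s o (⟨h, _⟩ | h | h)
    · cases h
    · exact hW1.final s o h
    · exact hW2.final s o h
  · rintro γ s o (⟨h, hP⟩ | h | h)
    · cases h
      by_cases hB : B.holds I s
      · exact ⟨_, _, .of_forced (c := (some γ1, s)) (fun _ => by simp [play, next, hB])
          (Or.inr (Or.inl (hP1 s o ⟨hP, hB⟩)))⟩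
      · exact ⟨_, _, .of_forced (c := (some γ2, s)) (fun _ => by simp [play, next, hB])
          (Or.inr (Or.inr (hP2 s o ⟨hP, hB⟩)))⟩
    · obtain ⟨x, v, hl⟩ := hW1.step γ s o h
      exact ⟨x, v, hl.mono fun _ _ h => Or.inr (Or.inl h)⟩
    · obtain ⟨x, v, hl⟩ := hW2.step γ s o h
      exact ⟨x, v, hl.mono fun _ _ h => Or.inr (Or.inr h)⟩

theorem Promises.while {P : EPred I} {B : BExp V F R} {γ : Mech Ag V F R}
    (h : Promises I (gate I B P) γ P) : Promises I P (.wh B γ) (gateN I B P) := by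
  obtain ⟨W, hW, hP⟩ := h
  refine ⟨fun c d => (c.1 = some (.wh B γ) ∧ (c.2, d) ∈ P) ∨ (c.1 = none ∧ (c.2, d) ∈ gateN I B P) ∨
    ∃ γ', c.1 = some (.seq γ' (.wh B γ)) ∧ W (some γ', c.2) d, ⟨?_, ?_⟩,
    fun s o h => Or.inl ⟨rfl, h⟩⟩
  · rintro s o (⟨h, _⟩ | ⟨_, h⟩ | ⟨_, h, _⟩)
    · cases h
    · exact h
    · cases h
  · rintro γ₀ s o (⟨h, hs⟩ | ⟨h, _⟩ | ⟨γ', h, hs⟩)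
    · cases h
      by_cases hB : B.holds I s
      · exact ⟨_, _, .of_forced (c := (some (.seq γ (.wh B γ)), s))
          (fun _ => by simp [play, next, hB]) (Or.inr (Or.inr ⟨γ, rfl, hP s o ⟨hs, hB⟩⟩))⟩
      · exact ⟨_, _, .of_forced (c := (none, s)) (fun _ => by simp [play, next, hB])
          (Or.inr (Or.inl ⟨rfl, hs, hB⟩))⟩
    · cases h
    · cases h
      obtain ⟨x, v, hl⟩ := hW.step γ' s o hs
      refine ⟨_, _, hl.seq ?_⟩
      rintro ⟨_ | γ'', s'⟩ d hd
      · exact Or.inl ⟨rfl, hW.final s' d hd⟩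
      · exact Or.inr (Or.inr ⟨γ'', rfl, hd⟩)

theorem Promises.conseq {P P' Q Q' : EPred I} {γ : Mech Ag V F R} (hP : P ⊆ P')
    (h : Promises I P' γ Q') (hQ : Q' ⊆ Q) : Promises I P γ Q := by
  obtain ⟨W, hW, hPW⟩ := h
  exact ⟨W, ⟨fun s o h => hQ (hW.final s o h), hW.step⟩, fun s o h => hPW s o (hP h)⟩

/-! ### Runs -/

theorem extend_of_some {σ : Profile I} {h : List (Cfg I)} {γ : Mech Ag V F R} {s : State I}
    (hl : h.getLast? = some (some γ, s)) :
    extend I σ h = h ++ [play I (fun a => σ a h) γ s] := by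
  rw [extend, hl, ← next_eq_play]

theorem extend_of_none {σ : Profile I} {h : List (Cfg I)} {s : State I}
    (hl : h.getLast? = some ((none : Option (Mech Ag V F R)), s)) :
    extend I σ h = h := by
  rw [extend, hl]

theorem runH_of_final {c : Cfg I} {σ : Profile I} {n : ℕ} {s : State I}
    (hl : (runH I c σ n).getLast? = some ((none : Option (Mech Ag V F R)), s)) :
    ∀ m, n ≤ m → runH I c σ m = runH I c σ n := by
  intro m hm
  induction m, hm using Nat.le_induction with
  | base => rfl
  | succ m _ ih => rw [runH, ih, extend_of_none hl]

theorem extend_cases (σ : Profile I) (h : List (Cfg I)) :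
    extend I σ h = h ∨ ∃ c, extend I σ h = h ++ [c] := by
  rw [extend]
  split
  · exact Or.inr ⟨_, rfl⟩
  · exact Or.inl rfl

theorem runH_ne_nil (c : Cfg I) (σ : Profile I) (n : ℕ) : runH I c σ n ≠ [] := by
  induction n with
  | zero => simp [runH]
  | succ n ih =>
    rw [runH]
    rcases extend_cases σ (runH I c σ n) with h | ⟨_, h⟩ <;> simp [h, ih]

/-- The `n`-th history is the list of the first `n + 1` configurations of the run. -/
theorem filterMap_runOf (c : Cfg I) (σ : Profile I) (n : ℕ) :
    (List.range (n + 1)).filterMap (runOf I c σ) = runH I c σ n := by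
  suffices h : (List.range (n + 1)).filterMap (runOf I c σ) = runH I c σ n ∧
      ((runH I c σ n).length = n + 1 ∨
        (runH I c σ n).length ≤ n + 1 ∧ extend I σ (runH I c σ n) = runH I c σ n) from h.1
  induction n with
  | zero => simp [runOf, runH, List.filterMap]
  | succ n ih =>
    obtain ⟨ih, hlen⟩ := ih
    rw [List.range_succ, List.filterMap_append, ih]
    by_cases hfix : extend I σ (runH I c σ n) = runH I c σ n
    · have hle : (runH I c σ n).length ≤ n + 1 := by rcases hlen with h | h <;> omega
      have hnone : runOf I c σ (n + 1) = none := by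
        rw [runOf, runH, hfix]; exact List.getElem?_eq_none hle
      rw [List.filterMap_cons, hnone]
      simp only [runH, hfix, List.filterMap_nil, List.append_nil, true_and]
      exact Or.inr ⟨by omega, trivial⟩
    · have hlen : (runH I c σ n).length = n + 1 := hlen.resolve_right fun h => hfix h.2
      obtain ⟨c', hc'⟩ := (extend_cases σ (runH I c σ n)).resolve_left hfix
      have hsome : runOf I c σ (n + 1) = some c' := by
        rw [runOf, runH, hc', ← hlen]; simp
      rw [List.filterMap_cons, hsome]
      simp [runH, hc', hlen]

theorem filterMap_prependRun (l : List (Cfg I)) (ρ : Run I) (n : ℕ) :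
    (List.range (l.length + n)).filterMap (prependRun I l ρ) =
      l ++ (List.range n).filterMap ρ := by
  rw [List.range_add, List.filterMap_append, List.filterMap_map]
  congr 1
  · rw [List.filterMap_congr (g := fun i => l[i]?)]
    · induction l using List.reverseRecOn with
      | nil => rfl
      | append_singleton l c ih =>
        rw [List.length_append, List.length_singleton, List.range_succ, List.filterMap_append,
          List.filterMap_congr (g := fun i => l[i]?), ih]
        · simp
        · intro i hi
          exact List.getElem?_append_left (List.mem_range.1 hi)
    · intro i hi
      have hi := List.mem_range.1 hi
      simp [prependRun, hi]
  · congr 1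
    funext i
    simp [prependRun]

theorem prependRun_nil (ρ : Run I) : prependRun I [] ρ = ρ := by
  funext n
  simp [prependRun]

/-! ### The choice mechanism -/

theorem Promises.choice (A : Finset Ag) (hA : A.Nonempty) (X : Ag → V) (hX : Set.InjOn X ↑A)
    (Q : EPred I) : Promises I (wpre I (.choice A hA X hX) Q) (.choice A hA X hX) Q := by
  set γ : Mech Ag V F R := .choice A hA X hX 
  refine ⟨fun c d => (c.1 = some γ ∧ (c.2, d) ∈ wpre I γ Q) ∨ (c.1 = none ∧ (c.2, d) ∈ Q),
    ⟨?_, ?_⟩, fun s o h => Or.inl ⟨rfl, h⟩⟩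
  · rintro s o (⟨h, _⟩ | ⟨_, h⟩)
    · cases h
    · exact h
  rintro γ₀ s o (⟨h, oh, σ, hmem, hspe, ho⟩ | ⟨h, _⟩)
  swap
  · cases h
  cases h
  set c : Cfg I := (some γ, s)
  have hone : ∀ τ : Profile I, runH I c τ 1 = [c, play I (fun a => τ a [c]) γ s] :=
    fun τ => extend_of_some (h := [c]) rfl
  have hlast : ∀ τ : Profile I, (runH I c τ 1).getLast? =
      some ((none : Option (Mech Ag V F R)), (play I (fun a => τ a [c]) γ s).2) :=
    fun τ => by rw [hone]; rfl
  have hrun : ∀ τ : Profile I,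
      runOf I c τ = fun n => [c, play I (fun a => τ a [c]) γ s][n]? := by
    intro τ
    funext n
    rcases n with _ | n
    · rfl
    · rw [runOf, runH_of_final (hlast τ) (n + 1) (by omega), hone]
  have hnash : ∀ (i : Ag) (τ : Profile I), (∀ j, j ≠ i → τ j = σ j) →
      I.pref i (oh (runOf I c σ)) (oh (runOf I c τ)) := by
    have hn := hspe [c] c ⟨rfl, List.isChain_singleton c⟩ rfl
    intro i τ hτ
    have := hn i τ hτ
    simp only [restrictO, List.dropLast_singleton, prependRun_nil] at this
    exact this
  refine ⟨fun a => σ a [c], fun c' => oh fun n => [c, c'][n]?, fun y => Or.inr ⟨rfl, ?_⟩, ?_, ?_⟩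
  · have ht : Terminates I c fun a _ => y a := ⟨1, _, hlast _⟩
    have hfin : finalState I ht = (play I y γ s).2 := by
      have hsp : (runH I c (fun a _ => y a) ht.choose).getLast? =
        some ((none : Option (Mech Ag V F R)), finalState I ht) := ht.choose_spec.choose_spec
      rcases hn : ht.choose with _ | n
      · rw [hn] at hsp
        cases hsp
      · rw [hn, runH_of_final (hlast _) (n + 1) (by omega), hlast] at hsp
        simpa using hsp.symm
    have := hmem _ ht
    rwa [hfin, hrun] at this
  · exact (congrArg oh (hrun σ).symm).trans ho
  · intro i y hy
    have := hnash i (fun j h => if j = i then y i else σ j h) (fun j hj => by simp [hj])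
    rw [hrun (fun j h => if j = i then y i else σ j h), show oh (runOf I c σ) = o from ho] at this
    have hj : (fun j => if j = i then y i else σ j [c]) = y := by
      funext j
      by_cases hj : j = i
      · simp [hj]
      · simp [hj, hy j hj]
    simpa only [hj] using this

theorem Deriv.promises {P Q : EPred I} {γ : Mech Ag V F R} (h : Deriv I P γ Q) :
    Promises I P γ Q := by
  induction h with
  | assign Q x t => exact .assign Q x t
  | choice A hA X hX Q => exact .choice A hA X hX Q
  | comp _ _ ih1 ih2 => exact ih1.comp ih2
  | ifR _ _ ih1 ih2 => exact .ite ih1 ih2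
  | whileR _ ih => exact .while ih
  | conseq hP _ hQ ih => exact .conseq hP ih hQ

/-! ### From promises to subgame-perfect equilibria -/

/-- The configuration and the promised outcome reached along a history starting in `p.1` with
promise `p.2`, where `v` updates the promise at each transition. -/
def promiseAlong (v : Cfg I → I.D → Cfg I → I.D) (p : Cfg I × I.D) (h : List (Cfg I)) :
    Cfg I × I.D :=
  h.tail.foldl (fun p c => (c, v p.1 p.2 c)) p

theorem promiseAlong_append (v : Cfg I → I.D → Cfg I → I.D) (p : Cfg I × I.D)
    {h : List (Cfg I)} (hh : h ≠ []) (c : Cfg I) :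
    promiseAlong v p (h ++ [c]) =
      (c, v (promiseAlong v p h).1 (promiseAlong v p h).2 c) := by
  rw [promiseAlong, promiseAlong, List.tail_append_of_ne_nil hh, List.foldl_append]
  rfl

/-- The value at which a sequence of outcomes stabilizes, and the worst outcome if there is none. -/
def eventualValue (I : Interp Ag V F R) (u : ℕ → I.D) : I.D :=
  if h : ∃ d, ∀ᶠ n in Filter.atTop, u n = d then h.choose else I.worst

theorem eventualValue_eq {u : ℕ → I.D} {d : I.D} (h : ∀ᶠ n in Filter.atTop, u n = d) :
    eventualValue I u = d := by
  have hex : ∃ d, ∀ᶠ n in Filter.atTop, u n = d := ⟨d, h⟩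
  rw [eventualValue, dif_pos hex]
  obtain ⟨n, h1, h2⟩ := (hex.choose_spec.and h).exists
  rw [← h1, h2]

theorem pref_eventualValue {u : ℕ → I.D} {i : Ag} {d : I.D}
    (h : ∀ᶠ n in Filter.atTop, I.pref i d (u n)) : I.pref i d (eventualValue I u) := by
  by_cases hex : ∃ d, ∀ᶠ n in Filter.atTop, u n = d
  · obtain ⟨e, he⟩ := hex
    rw [eventualValue_eq he]
    obtain ⟨n, h1, h2⟩ := (he.and h).exists
    rwa [h1] at h2
  · rw [eventualValue, dif_neg hex]
    exact I.worst_least i d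

/-- The outcome of a run is the promise that is eventually kept along it. -/
def promiseOutcome (v : Cfg I → I.D → Cfg I → I.D) (p : Cfg I × I.D) : OutcomeF I := fun ρ =>
  eventualValue I fun n => (promiseAlong v p ((List.range (n + 1)).filterMap ρ)).2

/-- Play the choices `x` prescribed for the current configuration and promise. -/
def promiseProfile (x : Cfg I → I.D → Ag → I.D) (v : Cfg I → I.D → Cfg I → I.D)
    (p : Cfg I × I.D) : Profile I := fun a h =>
  x (promiseAlong v p h).1 (promiseAlong v p h).2 a

theorem eventually_promise_prependRun {v : Cfg I → I.D → Cfg I → I.D} {p : Cfg I × I.D}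
    {l : List (Cfg I)} {c : Cfg I} {τ : Profile I} {r : I.D → Prop}
    (hr : ∀ᶠ n in Filter.atTop, r (promiseAlong v p (l ++ runH I c τ n)).2) :
    ∀ᶠ n in Filter.atTop,
      r (promiseAlong v p
        ((List.range (n + 1)).filterMap (prependRun I l (runOf I c τ)))).2 := by
  obtain ⟨N, hN⟩ := Filter.eventually_atTop.1 hr
  refine Filter.eventually_atTop.2 ⟨l.length + N, fun n hn => ?_⟩
  obtain ⟨k, rfl⟩ := Nat.exists_eq_add_of_le hn
  rw [show l.length + N + k + 1 = l.length + (N + k + 1) by omega, filterMap_prependRun,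
    filterMap_runOf]
  exact hN _ (by omega)

section Equilibrium

variable {W : Cfg I → I.D → Prop} {x : Cfg I → I.D → Ag → I.D} {v : Cfg I → I.D → Cfg I → I.D}
  {p : Cfg I × I.D}

theorem promiseAlong_of_isHist
    (hxv : ∀ γ s o, W (some γ, s) o → LocalEq W γ s o (x (some γ, s) o) (v (some γ, s) o))
    (hp : W p.1 p.2) {h : List (Cfg I)} {c : Cfg I} (hh : IsHist I p.1 h)
    (hc : h.getLast? = some c) :
    (promiseAlong v p h).1 = c ∧ W c (promiseAlong v p h).2 := by
  induction h using List.reverseRecOn generalizing c with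
  | nil => cases hc
  | append_singleton h c' ih =>
    obtain rfl : c' = c := by simpa using hc
    rcases List.eq_nil_or_concat' h with rfl | ⟨l, b, rfl⟩
    · obtain rfl : c' = p.1 := by simpa using hh.1
      exact ⟨rfl, hp⟩
    · have hne : l ++ [b] ≠ [] := by simp
      have hchain := List.isChain_append.1 hh.2
      obtain ⟨hb, hW⟩ := ih (c := b)
        ⟨by rw [← hh.1, List.head?_append_of_ne_nil _ hne], hchain.1⟩ (by simp)
      obtain ⟨L, hstep⟩ := hchain.2.2 b (by simp) c' (by simp)
      obtain ⟨γ, hγ, y, hy⟩ := hstep.exists_play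
      obtain ⟨m, s⟩ := b
      cases hγ
      rw [promiseAlong_append v p hne, hb, hy]
      exact ⟨rfl, (hxv γ s _ hW).succ y⟩

theorem promiseAlong_runH
    (hxv : ∀ γ s o, W (some γ, s) o → LocalEq W γ s o (x (some γ, s) o) (v (some γ, s) o))
    {l : List (Cfg I)} {c : Cfg I} (h1 : (promiseAlong v p (l ++ [c])).1 = c)
    (h2 : W c (promiseAlong v p (l ++ [c])).2) (τ : Profile I) (n : ℕ) :
    (runH I c τ n).getLast? = some (promiseAlong v p (l ++ runH I c τ n)).1 ∧
      W (promiseAlong v p (l ++ runH I c τ n)).1 (promiseAlong v p (l ++ runH I c τ n)).2 := by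
  induction n with
  | zero =>
    simp only [runH, h1]
    exact ⟨rfl, h2⟩
  | succ n ih =>
    obtain ⟨ihl, ihW⟩ := ih
    have hne : l ++ runH I c τ n ≠ [] := by simp [runH_ne_nil]
    rw [runH]
    rcases hc : (promiseAlong v p (l ++ runH I c τ n)).1 with ⟨_ | γ, s⟩ <;> rw [hc] at ihl ihW
    · rw [extend_of_none ihl, hc]
      exact ⟨ihl, ihW⟩
    · rw [extend_of_some ihl, ← List.append_assoc, promiseAlong_append v p hne, hc]
      exact ⟨by simp, (hxv γ s _ ihW).succ _⟩

/-- Along the continuation of a history, the promise never improves for an agent that deviates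
on its own. -/
theorem pref_promiseAlong_runH
    (hxv : ∀ γ s o, W (some γ, s) o → LocalEq W γ s o (x (some γ, s) o) (v (some γ, s) o))
    {l : List (Cfg I)} {c : Cfg I} (h1 : (promiseAlong v p (l ++ [c])).1 = c)
    (h2 : W c (promiseAlong v p (l ++ [c])).2) {τ : Profile I} {i : Ag}
    (hτ : ∀ j, j ≠ i → ∀ h, τ j h = promiseProfile x v p j (l ++ h)) (n : ℕ) :
    I.pref i (promiseAlong v p (l ++ [c])).2 (promiseAlong v p (l ++ runH I c τ n)).2 := by
  induction n with
  | zero => exact I.pref_refl _ _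
  | succ n ih =>
    refine I.pref_trans _ _ _ _ ih ?_
    obtain ⟨hl, hW⟩ := promiseAlong_runH hxv h1 h2 τ n
    have hne : l ++ runH I c τ n ≠ [] := by simp [runH_ne_nil]
    rw [runH]
    rcases hc : (promiseAlong v p (l ++ runH I c τ n)).1 with ⟨_ | γ, s⟩ <;> rw [hc] at hl hW
    · rw [extend_of_none hl]
      exact I.pref_refl _ _
    · rw [extend_of_some hl, ← List.append_assoc, promiseAlong_append v p hne, hc]
      refine (hxv γ s _ hW).stable i _ fun j hj => ?_
      rw [hτ j hj, promiseProfile, hc]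

/-- Along the continuation of a history by `promiseProfile`, the promise is kept. -/
theorem promiseAlong_runH_eq
    (hxv : ∀ γ s o, W (some γ, s) o → LocalEq W γ s o (x (some γ, s) o) (v (some γ, s) o))
    {l : List (Cfg I)} {c : Cfg I} (h1 : (promiseAlong v p (l ++ [c])).1 = c)
    (h2 : W c (promiseAlong v p (l ++ [c])).2) {τ : Profile I}
    (hτ : ∀ j h, τ j h = promiseProfile x v p j (l ++ h)) (n : ℕ) :
    (promiseAlong v p (l ++ runH I c τ n)).2 = (promiseAlong v p (l ++ [c])).2 := by
  induction n with
  | zero => rfl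
  | succ n ih =>
    refine Eq.trans ?_ ih
    obtain ⟨hl, hW⟩ := promiseAlong_runH hxv h1 h2 τ n
    have hne : l ++ runH I c τ n ≠ [] := by simp [runH_ne_nil]
    rw [runH]
    rcases hc : (promiseAlong v p (l ++ runH I c τ n)).1 with ⟨_ | γ, s⟩ <;> rw [hc] at hl hW
    · rw [extend_of_none hl]
    · rw [extend_of_some hl, ← List.append_assoc, promiseAlong_append v p hne, hc]
      convert (hxv γ s _ hW).value using 3
      funext j
      rw [hτ j, promiseProfile, hc]

end Equilibrium

theorem Promises.valid {P Q : EPred I} {γ : Mech Ag V F R} (h : Promises I P γ Q) :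
    Valid I P γ Q := by
  obtain ⟨W, hW, hP⟩ := h
  rintro ⟨s, o⟩ hso
  have hex : ∀ c o, ∃ x v, ∀ γ, c.1 = some γ → W c o → LocalEq W γ c.2 o x v := by
    rintro ⟨_ | γ, s⟩ o
    · exact ⟨fun _ => I.worst, fun _ => I.worst, fun _ h => by cases h⟩
    · by_cases hWo : W (some γ, s) o
      · obtain ⟨x, v, hl⟩ := hW.step γ s o hWo
        exact ⟨x, v, fun _ h _ => by cases h; exact hl⟩
      · exact ⟨fun _ => I.worst, fun _ => I.worst, fun _ _ h => absurd h hWo⟩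
  choose x v hxv' using hex
  have hxv : ∀ γ s o, W (some γ, s) o →
      LocalEq W γ s o (x (some γ, s) o) (v (some γ, s) o) :=
    fun γ s o h => hxv' (some γ, s) o γ rfl h
  set c0 : Cfg I := (some γ, s)
  set p : Cfg I × I.D := (c0, o)
  have hp : W p.1 p.2 := hP s o hso
  have houtcome : ∀ τ : Profile I, ∀ d : I.D,
      (∀ᶠ n in Filter.atTop, (promiseAlong v p (runH I c0 τ n)).2 = d) →
      promiseOutcome v p (runOf I c0 τ) = d := by
    intro τ d hd
    rw [← prependRun_nil (runOf I c0 τ)]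
    exact eventualValue_eq (eventually_promise_prependRun (l := []) (r := (· = d)) hd)
  refine ⟨promiseOutcome v p, promiseProfile x v p, ?_, ?_, ?_⟩
  · intro τ ht
    have hsp : (runH I c0 τ ht.choose).getLast? =
      some ((none : Option (Mech Ag V F R)), finalState I ht) := ht.choose_spec.choose_spec
    obtain ⟨hl, hWn⟩ := promiseAlong_runH (l := []) hxv rfl hp τ ht.choose
    rw [List.nil_append] at hl hWn
    rw [houtcome τ (promiseAlong v p (runH I c0 τ ht.choose)).2]
    · rw [← Option.some.inj (hsp.symm.trans hl)] at hWn
      exact hW.final _ _ hWn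
    · exact Filter.eventually_atTop.2 ⟨ht.choose, fun n hn => by rw [runH_of_final hsp n hn]⟩
  · intro h c hh hc i τ hτ
    obtain ⟨h1, h2⟩ := promiseAlong_of_isHist hxv hp hh hc
    rw [← List.dropLast_append_getLast? c hc] at h1 h2
    have hkeep : restrictO I h (promiseOutcome v p)
        (runOf I c (restrictP I h (promiseProfile x v p))) =
          (promiseAlong v p (h.dropLast ++ [c])).2 :=
      eventualValue_eq (eventually_promise_prependRun
        (r := (· = (promiseAlong v p (h.dropLast ++ [c])).2)) (.of_forall fun n =>
          promiseAlong_runH_eq hxv h1 h2 (fun _ _ => rfl) n))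
    rw [hkeep]
    exact pref_eventualValue (eventually_promise_prependRun
      (r := fun d => I.pref i (promiseAlong v p (h.dropLast ++ [c])).2 d) (.of_forall fun n =>
        pref_promiseAlong_runH hxv h1 h2 (fun j hj h' => by rw [hτ j hj]; rfl) n))
  · exact houtcome _ _ (.of_forall fun n =>
      promiseAlong_runH_eq (l := []) hxv rfl hp (fun _ _ => rfl) n)

end MPL

open MPL in
/-- Soundness: if `I ⊢ {P}γ{Q}` is derivable in the Hoare-style calculus for
mechanisms, then `I ⊨ {P}γ{Q}`. -/
theorem soundness {Ag V F R : Type} (I : Interp Ag V F R)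
    (γ : Mech Ag V F R) (P Q : EPred I)
    (h : Deriv I P γ Q) : Valid I P γ Q := by
  exact h.promises.valid
end
end
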